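/- arXiv:2203.05519 — 9 statements merged into one kernel-verified Lean document; each statement's English description precedes it below -/
import Mathlib

section
/- Let t > −1, let s ∈ [0,1], let k ≥ 1, and let z₁, z₂ ∈ ℝᵏ satisfy s + |z₁| + |z₂| > 0. Then there exists a constant c ≥ 1, depending only on t, such that c⁻¹ (s² + |z₁|² + |z₂|²)^{t/2} ≤ ∫₀¹ [s² + |z₁ + y(z₂ − z₁)|²]^{t/2} dy ≤ c (s² + |z₁|² + |z₂|²)^{t/2}. -/
open MeasureTheory

lemma seg_abs_int (t : ℝ) (ht : -1 < t) (a : ℝ) (h0 : 0 ≤ a) (h1 : a ≤ 1) :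
    IntervalIntegrable (fun y : ℝ => |y - a| ^ t) volume 0 1 ∧
    (∫ y in (0:ℝ)..1, |y - a| ^ t) = (a ^ (t+1) + (1-a) ^ (t+1)) / (t+1) := by
  have hI : ∀ b c : ℝ, IntervalIntegrable (fun y : ℝ => y ^ t) volume b c := fun b c =>
    intervalIntegral.intervalIntegrable_rpow' ht
  have i1 : IntervalIntegrable (fun y : ℝ => (a - y) ^ t) volume 0 a := by
    have := (hI a 0).comp_sub_left a
    simpa using this
  have i2 : IntervalIntegrable (fun y : ℝ => (y - a) ^ t) volume a 1 := by
    have := (hI 0 (1-a)).comp_sub_right a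
    simpa using this
  have e1 : Set.EqOn (fun y : ℝ => (a - y) ^ t) (fun y : ℝ => |y - a| ^ t) (Set.uIcc 0 a) := by
    intro y hy
    rw [Set.uIcc_of_le h0] at hy
    simp only
    rw [abs_of_nonpos (by linarith [hy.2])]; congr 1; ring
  have e2 : Set.EqOn (fun y : ℝ => (y - a) ^ t) (fun y : ℝ => |y - a| ^ t) (Set.uIcc a 1) := by
    intro y hy
    rw [Set.uIcc_of_le h1] at hy
    simp only
    rw [abs_of_nonneg (by linarith [hy.1])]
  have j1 : IntervalIntegrable (fun y : ℝ => |y - a| ^ t) volume 0 a :=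
    i1.congr (fun y hy => e1 (Set.uIoc_subset_uIcc hy))
  have j2 : IntervalIntegrable (fun y : ℝ => |y - a| ^ t) volume a 1 :=
    i2.congr (fun y hy => e2 (Set.uIoc_subset_uIcc hy))
  refine ⟨j1.trans j2, ?_⟩
  rw [← intervalIntegral.integral_add_adjacent_intervals j1 j2,
    ← intervalIntegral.integral_congr e1, ← intervalIntegral.integral_congr e2,
    intervalIntegral.integral_comp_sub_left (fun x => x ^ t),
    intervalIntegral.integral_comp_sub_right (fun x => x ^ t),
    integral_rpow (Or.inl ht), integral_rpow (Or.inl ht)]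
  have : t + 1 ≠ 0 := by linarith
  simp [Real.zero_rpow this]
  ring

lemma seg_bounds (t : ℝ) (ht : -1 < t) (a : ℝ) (h0 : 0 ≤ a) (h1 : a ≤ 1) :
    (1/2:ℝ) ^ (t+1) / (t+1) ≤ (a ^ (t+1) + (1-a) ^ (t+1)) / (t+1) ∧
    (a ^ (t+1) + (1-a) ^ (t+1)) / (t+1) ≤ 2 / (t+1) := by
  have hp : 0 < t + 1 := by linarith
  have p1 : 0 ≤ a ^ (t+1) := Real.rpow_nonneg h0 _
  have p2 : 0 ≤ (1-a) ^ (t+1) := Real.rpow_nonneg (by linarith) _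
  constructor
  · apply div_le_div_of_nonneg_right _ hp.le
    rcases le_total (1/2) a with h | h
    · have := Real.rpow_le_rpow (by norm_num) h hp.le
      linarith
    · have := Real.rpow_le_rpow (by norm_num) (show (1/2:ℝ) ≤ 1 - a by linarith) hp.le
      linarith
  · apply div_le_div_of_nonneg_right _ hp.le
    have := Real.rpow_le_one h0 h1 hp.le
    have := Real.rpow_le_one (show 0 ≤ 1 - a by linarith) (by linarith) hp.le
    linarith

lemma seg_key {E : Type*} [NormedAddCommGroup E] [InnerProductSpace ℝ E] (s : ℝ) (z₁ z₂ : E) :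
    ∃ a : ℝ, 0 ≤ a ∧ a ≤ 1 ∧ ∀ y : ℝ, 0 ≤ y → y ≤ 1 →
      (s ^ 2 + ‖z₁‖ ^ 2 + ‖z₂‖ ^ 2) / 8 * |y - a| ^ 2 ≤ s ^ 2 + ‖z₁ + y • (z₂ - z₁)‖ ^ 2 ∧
      s ^ 2 + ‖z₁ + y • (z₂ - z₁)‖ ^ 2 ≤ s ^ 2 + ‖z₁‖ ^ 2 + ‖z₂‖ ^ 2 := by
  have hex : ∀ y : ℝ, ‖z₁ + y • (z₂ - z₁)‖ ^ 2
      = ‖z₁‖^2 + 2 * y * (inner ℝ z₁ (z₂ - z₁)) + y^2 * ‖z₂ - z₁‖^2 := by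
    intro y
    rw [norm_add_sq_real, inner_smul_right, norm_smul, mul_pow, Real.norm_eq_abs, sq_abs]
    ring
  have h2 : ‖z₂‖^2 = ‖z₁‖^2 + 2 * (inner ℝ z₁ (z₂ - z₁)) + ‖z₂ - z₁‖^2 := by
    have := hex 1
    simpa using this
  have hnn : ∀ y : ℝ, 0 ≤ ‖z₁‖^2 + 2 * y * (inner ℝ z₁ (z₂ - z₁)) + y^2 * ‖z₂ - z₁‖^2 := by
    intro y; rw [← hex]; positivity
  simp only [hex, h2, sq_abs]
  generalize (inner ℝ z₁ (z₂ - z₁)) = B at *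
  have hA : 0 ≤ ‖z₁‖^2 := by positivity
  have hD : 0 ≤ ‖z₂ - z₁‖^2 := by positivity
  have hA2 : 0 ≤ ‖z₂‖^2 := by positivity
  rw [h2] at hA2
  generalize ‖z₁‖^2 = A at *
  generalize ‖z₂ - z₁‖^2 = D at *
  obtain ⟨a, ⟨h0, h1⟩, hmin⟩ := (isCompact_Icc (a := (0:ℝ)) (b := 1)).exists_isMinOn
    (f := fun y => A + 2 * y * B + y^2 * D) ⟨0, by simp⟩ (by fun_prop)
  refine ⟨a, h0, h1, fun y hy0 hy1 => ⟨?_, ?_⟩⟩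
  · have hm := hmin (show (a+y)/2 ∈ Set.Icc (0:ℝ) 1 by constructor <;> linarith)
    simp only [Set.mem_ofPred_eq] at hm
    have hlow : A + 2 * a * B + a^2 * D + D * (y-a)^2 / 2 ≤ A + 2 * y * B + y^2 * D := by
      nlinarith
    have hq : (y-a)^2 ≤ 1 := by
      rw [sq_le_one_iff_abs_le_one, abs_le]; constructor <;> linarith
    set F := A + 2 * a * B + a^2 * D with hF
    have hF0 : 0 ≤ F := hnn a
    -- parallelogram-type bounds
    have b1 : A ≤ 2 * F + 2 * (a^2 * D) := by
      have := hnn (2*a)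
      nlinarith
    have b2 : A + 2 * B + D ≤ 2 * F + 2 * ((1-a)^2 * D) := by
      have := hnn (2*a-1)
      nlinarith
    have b3 : a^2 + (1-a)^2 ≤ 1 := by nlinarith
    have b4 : (a^2 + (1-a)^2) * D ≤ D := by nlinarith
    have hQ : (s^2 + A + (A + 2 * B + D)) ≤ 4 * (s^2 + F) + 2 * D := by nlinarith [sq_nonneg s]
    have hq0 := sq_nonneg (y-a)
    have hs := sq_nonneg s
    calc (s^2 + A + (A + 2 * B + D)) / 8 * (y-a)^2 
        ≤ (4 * (s^2 + F) + 2 * D) / 8 * (y-a)^2 := by gcongr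
      _ = (s^2+F)/2 * (y-a)^2 + D * (y-a)^2 / 4 := by ring
      _ ≤ (s^2+F) + D * (y-a)^2/2 := by nlinarith [mul_nonneg hD hq0]
      _ ≤ _ := by linarith
  · have : y^2 * D ≤ y * D := mul_le_mul_of_nonneg_right (by nlinarith) hD
    nlinarith [mul_nonneg hy0 hA, mul_nonneg (sub_nonneg.2 hy1) hA2]

theorem segment_integral_equiv (t : ℝ) (ht : -1 < t) :
    ∃ c : ℝ, 1 ≤ c ∧
      ∀ (k : ℕ), 1 ≤ k → ∀ (s : ℝ), 0 ≤ s → s ≤ 1 →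
        ∀ z₁ z₂ : EuclideanSpace ℝ (Fin k), 0 < s + ‖z₁‖ + ‖z₂‖ →
          c⁻¹ * (s ^ 2 + ‖z₁‖ ^ 2 + ‖z₂‖ ^ 2) ^ (t / 2) ≤
              (∫ y in (0:ℝ)..1, (s ^ 2 + ‖z₁ + y • (z₂ - z₁)‖ ^ 2) ^ (t / 2)) ∧
            (∫ y in (0:ℝ)..1, (s ^ 2 + ‖z₁ + y • (z₂ - z₁)‖ ^ 2) ^ (t / 2)) ≤
              c * (s ^ 2 + ‖z₁‖ ^ 2 + ‖z₂‖ ^ 2) ^ (t / 2) := by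
  have hp : 0 < t + 1 := by linarith
  set m : ℝ := (1/2:ℝ) ^ (t+1) / (t+1) with hm
  have hm0 : 0 < m := by positivity
  set w : ℝ := (1/8:ℝ) ^ (t/2) with hw
  have hw0 : 0 < w := by positivity
  have hM0 : 0 < 2 / (t+1) := by positivity
  refine ⟨max 1 (max (w * m)⁻¹ (w * (2/(t+1)))), le_max_left _ _, ?_⟩
  intro k _ s hs0 _ z₁ z₂ hpos
  set c := max 1 (max (w * m)⁻¹ (w * (2/(t+1)))) with hc
  have c1 : 1 ≤ c := le_max_left _ _
  have c2 : (w * m)⁻¹ ≤ c := (le_max_left _ _).trans (le_max_right _ _)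
  have c3 : w * (2/(t+1)) ≤ c := (le_max_right _ _).trans (le_max_right _ _)
  have c1' : c⁻¹ ≤ 1 := inv_le_one_of_one_le₀ c1
  have c2' : c⁻¹ ≤ w * m := inv_le_of_inv_le₀ (by positivity) c2
  obtain ⟨a, h0, h1, hk⟩ := seg_key s z₁ z₂
  obtain ⟨hint, hval⟩ := seg_abs_int t ht a h0 h1
  obtain ⟨hlo, hhi⟩ := seg_bounds t ht a h0 h1
  rw [← hval] at hlo hhi
  have hQ : 0 < s ^ 2 + ‖z₁‖ ^ 2 + ‖z₂‖ ^ 2 := by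
    by_contra hcon
    have n1 := norm_nonneg z₁
    have n2 := norm_nonneg z₂
    have a1 : s = 0 := by nlinarith [sq_nonneg s, sq_nonneg ‖z₁‖, sq_nonneg ‖z₂‖]
    have a2 : ‖z₁‖ = 0 := by nlinarith [sq_nonneg s, sq_nonneg ‖z₁‖, sq_nonneg ‖z₂‖]
    have a3 : ‖z₂‖ = 0 := by nlinarith [sq_nonneg s, sq_nonneg ‖z₁‖, sq_nonneg ‖z₂‖]
    linarith
  set Q := s ^ 2 + ‖z₁‖ ^ 2 + ‖z₂‖ ^ 2 with hQd
  have hQt : 0 < Q ^ (t/2) := by positivity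
  have hG : ∀ y : ℝ, (Q / 8 * |y - a| ^ 2) ^ (t/2) = w * Q ^ (t/2) * |y - a| ^ t := by
    intro y
    rw [Real.mul_rpow (by positivity) (by positivity), div_eq_mul_one_div,
      Real.mul_rpow (by positivity) (by positivity), ← Real.rpow_natCast |y - a| 2,
      ← Real.rpow_mul (abs_nonneg _), hw]
    have : ((2:ℕ):ℝ) * (t/2) = t := by push_cast; ring
    rw [this]; ring
  have hGint : IntervalIntegrable (fun y : ℝ => w * Q ^ (t/2) * |y - a| ^ t) volume 0 1 :=
    hint.const_mul _
  have hGval : (∫ y in (0:ℝ)..1, w * Q ^ (t/2) * |y - a| ^ t)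
      = w * Q ^ (t/2) * ∫ y in (0:ℝ)..1, |y - a| ^ t := intervalIntegral.integral_const_mul _ _
  have hCint : IntervalIntegrable (fun _ : ℝ => Q ^ (t/2)) volume 0 1 := intervalIntegrable_const
  have hCval : (∫ _ in (0:ℝ)..1, Q ^ (t/2)) = Q ^ (t/2) := by simp
  have hfc : Continuous (fun y : ℝ => s ^ 2 + ‖z₁ + y • (z₂ - z₁)‖ ^ 2) := by fun_prop
  have hae : ∀ᵐ y : ℝ ∂(volume.restrict (Set.Icc (0:ℝ) 1)), y ∈ Set.Icc (0:ℝ) 1 ∧ y ≠ a := by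
    have q1 := ae_restrict_mem (μ := (volume : Measure ℝ)) (measurableSet_Icc (a := (0:ℝ)) (b := 1))
    have q2 : ∀ᵐ y : ℝ ∂(volume.restrict (Set.Icc (0:ℝ) 1)), y ≠ a :=
      ae_restrict_of_ae (Measure.ae_ne volume a)
    filter_upwards [q1, q2] with y hy1 hy2 using ⟨hy1, hy2⟩
  rcases le_or_gt 0 t with h | h
  · have hfi : IntervalIntegrable (fun y : ℝ => (s ^ 2 + ‖z₁ + y • (z₂ - z₁)‖ ^ 2) ^ (t / 2))
        volume 0 1 :=
      (hfc.rpow_const (fun _ => Or.inr (by linarith))).intervalIntegrable _ _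
    constructor
    · have := intervalIntegral.integral_mono_on zero_le_one hGint hfi (fun y hy => by
        rw [← hG]
        exact Real.rpow_le_rpow (by positivity) (hk y hy.1 hy.2).1 (by linarith))
      rw [hGval] at this
      calc c⁻¹ * Q ^ (t/2) ≤ (w * m) * Q ^ (t/2) := by gcongr
        _ = w * Q ^ (t/2) * m := by ring
        _ ≤ w * Q ^ (t/2) * ∫ y in (0:ℝ)..1, |y - a| ^ t := by gcongr
        _ ≤ _ := this
    · have := intervalIntegral.integral_mono_on zero_le_one hfi hCint (fun y hy => 
        Real.rpow_le_rpow (by positivity) (hk y hy.1 hy.2).2 (by linarith))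
      rw [hCval] at this
      nlinarith
  · have hup : ∀ y : ℝ, (y ∈ Set.Icc (0:ℝ) 1 ∧ y ≠ a) →
        (s ^ 2 + ‖z₁ + y • (z₂ - z₁)‖ ^ 2) ^ (t / 2) ≤ w * Q ^ (t/2) * |y - a| ^ t := by
      rintro y ⟨hy, hya⟩
      rw [← hG]
      have : 0 < |y - a| := abs_pos.mpr (sub_ne_zero.mpr hya)
      exact Real.rpow_le_rpow_of_nonpos (by positivity) (hk y hy.1 hy.2).1 (by linarith)
    have hdn : ∀ y : ℝ, (y ∈ Set.Icc (0:ℝ) 1 ∧ y ≠ a) →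
        Q ^ (t/2) ≤ (s ^ 2 + ‖z₁ + y • (z₂ - z₁)‖ ^ 2) ^ (t / 2) := by
      rintro y ⟨hy, hya⟩
      have h3 : 0 < |y - a| := abs_pos.mpr (sub_ne_zero.mpr hya)
      have h4 : 0 < Q / 8 * |y - a| ^ 2 := by positivity
      exact Real.rpow_le_rpow_of_nonpos (h4.trans_le (hk y hy.1 hy.2).1) (hk y hy.1 hy.2).2
        (by linarith)
    have hfi : IntervalIntegrable (fun y : ℝ => (s ^ 2 + ‖z₁ + y • (z₂ - z₁)‖ ^ 2) ^ (t / 2))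
        volume 0 1 := by
      refine hGint.mono_fun' (hfc.measurable.pow_const _).aestronglyMeasurable ?_
      rw [Set.uIoc_of_le zero_le_one]
      have := ae_restrict_of_ae_restrict_of_subset Set.Ioc_subset_Icc_self hae
      filter_upwards [this] with y hy
      rw [Real.norm_of_nonneg (by positivity)]
      exact hup y hy
    constructor
    · have := intervalIntegral.integral_mono_ae_restrict zero_le_one hCint hfi
        (by filter_upwards [hae] with y hy using hdn y hy)
      rw [hCval] at this
      nlinarith
    · have := intervalIntegral.integral_mono_ae_restrict zero_le_one hfi hGint
        (by filter_upwards [hae] with y hy using hup y hy)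
      rw [hGval] at this
      calc _ ≤ _ := this
        _ ≤ w * Q ^ (t/2) * (2/(t+1)) := by gcongr
        _ = (w * (2/(t+1))) * Q ^ (t/2) := by ring
        _ ≤ _ := by gcongr
end

section
/- Let p ∈ (1,2), s ≥ 0 and k ≥ 1. Then there exists a constant c ≥ 1, depending only on p, such that for all z₁, z₂ ∈ ℝᵏ with s + |z₁| + |z₂| > 0 one has c⁻¹ (s² + |z₁|² + |z₂|²)^{(p−2)/4} |z₁ − z₂| ≤ |V_{s,p}(z₁) − V_{s,p}(z₂)| ≤ c (s² + |z₁|² + |z₂|²)^{(p−2)/4} |z₁ − z₂|. -/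
/-- The vector field `V_{s,p}(z) := (s² + |z|²)^{(p−2)/4} z` on `ℝᵏ`. -/
noncomputable def Vsp {k : ℕ} (s p : ℝ) (z : EuclideanSpace ℝ (Fin k)) :
    EuclideanSpace ℝ (Fin k) :=
  ((s ^ 2 + ‖z‖ ^ 2) ^ ((p - 2) / 4)) • z

lemma key_scalar (q s a b : ℝ) (hq : 0 < q) (hq4 : q ≤ 1 / 4)
    (hb : 0 ≤ b) (hab : b ≤ a) :
    (s ^ 2 + b ^ 2) ^ (-q) * b ≤ (s ^ 2 + a ^ 2) ^ (-q) * ((a + b) / 2) := by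
  rcases hb.eq_or_lt with rfl | hb
  · rw [mul_zero]; positivity
  have ha : 0 < a := hb.trans_le hab
  have hA : 0 < s ^ 2 + a ^ 2 := by positivity
  have hB : 0 < s ^ 2 + b ^ 2 := by positivity
  have hab2 : b ^ 2 ≤ a ^ 2 := by gcongr
  have hx0 : 0 < (a + b) / (2 * b) := by positivity
  have h1 : 1 ≤ (s ^ 2 + a ^ 2) / (s ^ 2 + b ^ 2) := by
    rw [le_div_iff₀ hB]; linarith
  have h2 : (s ^ 2 + a ^ 2) / (s ^ 2 + b ^ 2) ≤ ((a + b) / (2 * b)) ^ 4 := by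
    have e1 : (s ^ 2 + a ^ 2) / (s ^ 2 + b ^ 2) ≤ a ^ 2 / b ^ 2 := by
      rw [div_le_div_iff₀ hB (by positivity)]
      nlinarith [mul_le_mul_of_nonneg_left hab2 (sq_nonneg s)]
    have e2 : a / b ≤ ((a + b) / (2 * b)) ^ 2 := by
      rw [div_pow, div_le_div_iff₀ hb (by positivity)]
      nlinarith [mul_nonneg hb.le (sq_nonneg (a - b))]
    have e3 : (a / b) ^ 2 ≤ (((a + b) / (2 * b)) ^ 2) ^ 2 := by gcongr
    calc _ ≤ a ^ 2 / b ^ 2 := e1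
      _ = (a / b) ^ 2 := by rw [div_pow]
      _ ≤ _ := e3
      _ = _ := by ring
  have h3 : ((s ^ 2 + a ^ 2) / (s ^ 2 + b ^ 2)) ^ q ≤ (a + b) / (2 * b) := by
    calc _ ≤ ((s ^ 2 + a ^ 2) / (s ^ 2 + b ^ 2)) ^ (1 / 4 : ℝ) :=
          Real.rpow_le_rpow_of_exponent_le h1 hq4
      _ ≤ (((a + b) / (2 * b)) ^ 4) ^ (1 / 4 : ℝ) :=
          Real.rpow_le_rpow (by positivity) h2 (by norm_num)
      _ = (a + b) / (2 * b) := by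
          rw [← Real.rpow_natCast, ← Real.rpow_mul hx0.le]; norm_num
  rw [Real.div_rpow hA.le hB.le] at h3
  rw [Real.rpow_neg hA.le, Real.rpow_neg hB.le]
  have hAq := Real.rpow_pos_of_pos hA q
  have hBq := Real.rpow_pos_of_pos hB q
  rw [div_le_div_iff₀ hBq (by positivity)] at h3
  rw [inv_mul_eq_div, inv_mul_eq_div, div_le_div_iff₀ hBq hAq]
  linarith

lemma core {k : ℕ} (α β : ℝ) (z₁ z₂ : EuclideanSpace ℝ (Fin k)) (hα : 0 ≤ α) (hαβ : α * ‖z₂‖ ≤ β * ‖z₂‖)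
    (h12 : ‖z₂‖ ≤ ‖z₁‖)
    (h : β * ‖z₂‖ ≤ α * ((‖z₁‖ + ‖z₂‖) / 2)) :
    α / 2 * ‖z₁ - z₂‖ ≤ ‖α • z₁ - β • z₂‖ ∧ ‖α • z₁ - β • z₂‖ ≤ 2 * α * ‖z₁ - z₂‖ := by
  have ht : ‖z₁‖ - ‖z₂‖ ≤ ‖z₁ - z₂‖ := norm_sub_norm_le _ _
  have h2 := norm_nonneg z₂
  constructor
  · refine le_of_pow_le_pow_left₀ (n := 2) (by norm_num) (norm_nonneg _) ?_
    have hcs := real_inner_le_norm z₁ z₂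
    rw [mul_pow, norm_sub_sq_real, norm_sub_sq_real, norm_smul, norm_smul, inner_smul_left,
      inner_smul_right, mul_pow, mul_pow, Real.norm_eq_abs, Real.norm_eq_abs, sq_abs, sq_abs]
    simp only [conj_trivial]
    set a := ‖z₁‖
    set b := ‖z₂‖
    set i := inner ℝ z₁ z₂
    have e1 : α / 2 * (a - b) ≤ α * a - β * b := by linarith
    have e0 : 0 ≤ α / 2 * (a - b) := mul_nonneg (by linarith) (by linarith)
    have e2 : (α / 2 * (a - b)) ^ 2 ≤ (α * a - β * b) ^ 2 := by gcongr
    have e3 : α ^ 2 / 4 * (a * b - i) ≤ α * β * (a * b - i) := by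
      rcases h2.eq_or_lt with hb | hb
      · have : z₂ = 0 := norm_eq_zero.mp hb.symm
        have hi : i = 0 := by simp [i, this]
        have hb' : b = 0 := hb.symm
        simp [hi, hb']
      · have : α ≤ β := le_of_mul_le_mul_right hαβ hb
        have : α ^ 2 / 4 ≤ α * β := by nlinarith
        exact mul_le_mul_of_nonneg_right this (by linarith)
    nlinarith
  · have e : α • z₁ - β • z₂ = α • (z₁ - z₂) - (β - α) • z₂ := by module
    have hn : ‖(β - α) • z₂‖ ≤ α * ‖z₁ - z₂‖ := by
      have : ‖(β - α) • z₂‖ = (β - α) * ‖z₂‖ := by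
        rw [norm_smul, Real.norm_eq_abs]
        conv_lhs => rw [← abs_of_nonneg h2, ← abs_mul]
        rw [abs_of_nonneg (by linarith)]
      rw [this]
      nlinarith [mul_le_mul_of_nonneg_left ht hα, mul_le_mul_of_nonneg_left h12 hα]
    calc _ ≤ ‖α • (z₁ - z₂)‖ + ‖(β - α) • z₂‖ := by rw [e]; exact norm_sub_le _ _
      _ ≤ α * ‖z₁ - z₂‖ + α * ‖z₁ - z₂‖ := by
        rw [norm_smul, Real.norm_eq_abs, abs_of_nonneg hα]; gcongr
      _ = _ := by ring

lemma Vsp_ordered (p : ℝ) (hp : 1 < p) (hp2 : p < 2) (s : ℝ) (hs : 0 ≤ s) (k : ℕ)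
    (z₁ z₂ : EuclideanSpace ℝ (Fin k)) (h0 : 0 < s + ‖z₁‖ + ‖z₂‖) (h12 : ‖z₂‖ ≤ ‖z₁‖) :
    4⁻¹ * (s ^ 2 + ‖z₁‖ ^ 2 + ‖z₂‖ ^ 2) ^ ((p - 2) / 4) * ‖z₁ - z₂‖ ≤
              ‖Vsp s p z₁ - Vsp s p z₂‖ ∧
            ‖Vsp s p z₁ - Vsp s p z₂‖ ≤
              4 * (s ^ 2 + ‖z₁‖ ^ 2 + ‖z₂‖ ^ 2) ^ ((p - 2) / 4) * ‖z₁ - z₂‖ := by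
  have hk := key_scalar ((2 - p) / 4) s ‖z₁‖ ‖z₂‖ (by linarith) (by linarith) (norm_nonneg _) h12
  have hpe : -((2 - p) / 4) = (p - 2) / 4 := by ring
  rw [hpe] at hk
  have hr : (p - 2) / 4 ≤ 0 := by linarith
  have h2 := norm_nonneg z₂
  have hsq : ‖z₂‖ ^ 2 ≤ ‖z₁‖ ^ 2 := by gcongr
  have hA : 0 < s ^ 2 + ‖z₁‖ ^ 2 := by
    rcases hs.eq_or_lt with rfl | hs
    · have : 0 < ‖z₁‖ := by linarith
      positivity
    · positivity
  have hc := core ((s ^ 2 + ‖z₁‖ ^ 2) ^ ((p - 2) / 4)) ((s ^ 2 + ‖z₂‖ ^ 2) ^ ((p - 2) / 4)) z₁ z₂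
    (by positivity) (by
      rcases h2.eq_or_lt with hb | hb
      · rw [← hb]; simp
      · exact mul_le_mul_of_nonneg_right
          (Real.rpow_le_rpow_of_nonpos (by positivity) (by linarith) hr) h2) h12 hk
  have m1 : (s ^ 2 + ‖z₁‖ ^ 2 + ‖z₂‖ ^ 2) ^ ((p - 2) / 4) ≤ (s ^ 2 + ‖z₁‖ ^ 2) ^ ((p - 2) / 4) :=
    Real.rpow_le_rpow_of_nonpos hA (by nlinarith) hr
  have m2 : (s ^ 2 + ‖z₁‖ ^ 2) ^ ((p - 2) / 4) ≤
      2 * (s ^ 2 + ‖z₁‖ ^ 2 + ‖z₂‖ ^ 2) ^ ((p - 2) / 4) := by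
    have t1 : (2 * (s ^ 2 + ‖z₁‖ ^ 2)) ^ ((p - 2) / 4) ≤
        (s ^ 2 + ‖z₁‖ ^ 2 + ‖z₂‖ ^ 2) ^ ((p - 2) / 4) :=
      Real.rpow_le_rpow_of_nonpos (by positivity) (by nlinarith [sq_nonneg s]) hr
    rw [Real.mul_rpow (by norm_num) hA.le] at t1
    have t2 : (2 : ℝ) ^ (-1 : ℝ) ≤ 2 ^ ((p - 2) / 4) :=
      Real.rpow_le_rpow_of_exponent_le (by norm_num) (by linarith)
    rw [Real.rpow_neg_one] at t2
    have t3 := mul_le_mul_of_nonneg_right t2 (Real.rpow_nonneg hA.le ((p - 2) / 4))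
    linarith
  have hM : 0 ≤ (s ^ 2 + ‖z₁‖ ^ 2 + ‖z₂‖ ^ 2) ^ ((p - 2) / 4) := by positivity
  unfold Vsp
  constructor
  · refine le_trans ?_ hc.1
    refine mul_le_mul_of_nonneg_right ?_ (norm_nonneg _)
    linarith
  · refine le_trans hc.2 ?_
    refine mul_le_mul_of_nonneg_right ?_ (norm_nonneg _)
    linarith

/-- For `p ∈ (1,2)` there is `c = c(p) ≥ 1` such that for all `s ≥ 0`, `k ≥ 1` and
`z₁, z₂ ∈ ℝᵏ` with `s + |z₁| + |z₂| > 0`,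
`|V_{s,p}(z₁) − V_{s,p}(z₂)| ≈ (s² + |z₁|² + |z₂|²)^{(p−2)/4} |z₁ − z₂|`. -/
theorem Vsp_diff_equiv (p : ℝ) (hp : 1 < p) (hp2 : p < 2) :
    ∃ c : ℝ, 1 ≤ c ∧
      ∀ (s : ℝ), 0 ≤ s → ∀ (k : ℕ), 1 ≤ k →
        ∀ z₁ z₂ : EuclideanSpace ℝ (Fin k), 0 < s + ‖z₁‖ + ‖z₂‖ →
          c⁻¹ * (s ^ 2 + ‖z₁‖ ^ 2 + ‖z₂‖ ^ 2) ^ ((p - 2) / 4) * ‖z₁ - z₂‖ ≤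
              ‖Vsp s p z₁ - Vsp s p z₂‖ ∧
            ‖Vsp s p z₁ - Vsp s p z₂‖ ≤
              c * (s ^ 2 + ‖z₁‖ ^ 2 + ‖z₂‖ ^ 2) ^ ((p - 2) / 4) * ‖z₁ - z₂‖ := by
  refine ⟨4, by norm_num, ?_⟩
  intro s hs k _ z₁ z₂ h0
  rcases le_total ‖z₂‖ ‖z₁‖ with h | h
  · exact Vsp_ordered p hp hp2 s hs k z₁ z₂ h0 h
  · have := Vsp_ordered p hp hp2 s hs k z₂ z₁ (by linarith) h
    rw [norm_sub_rev z₂ z₁, norm_sub_rev (Vsp s p z₂), add_right_comm] at this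
    exact this
end

section
/- Let p ∈ (1,2), s ≥ 0 and k ≥ 1. Then there exists a constant c ≥ 1, depending only on p, such that for all z₁, z₂ ∈ ℝᵏ one has |V_{s,p}(z₁ + z₂)| ≤ c (|V_{s,p}(z₁)| + |V_{s,p}(z₂)|). -/
lemma aux_anti (s e t u : ℝ) (he : e ≤ 0) (ht : 0 ≤ t) (htu : t ≤ u) :
    (s ^ 2 + u ^ 2) ^ e * t ≤ (s ^ 2 + t ^ 2) ^ e * t := by
  rcases ht.eq_or_lt with rfl | ht
  · simp
  · refine mul_le_mul_of_nonneg_right ?_ ht.le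
    exact Real.rpow_le_rpow_of_nonpos (by positivity) (by gcongr) he

lemma aux_mono (s e t u : ℝ) (he : e ≤ 0) (he' : -(1 / 2) ≤ e) (ht : 0 ≤ t) (htu : t ≤ u) :
    (s ^ 2 + t ^ 2) ^ e * t ≤ (s ^ 2 + u ^ 2) ^ e * u := by
  rcases ht.eq_or_lt with rfl | ht
  · simp only [mul_zero]
    positivity
  · have hu : 0 < u := ht.trans_le htu
    have hr : 1 ≤ u / t := (one_le_div ht).2 htu
    have h1 : s ^ 2 + u ^ 2 ≤ (u / t) ^ 2 * (s ^ 2 + t ^ 2) := by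
      have h2 : (u / t) ^ 2 * (s ^ 2 + t ^ 2) = (u / t) ^ 2 * s ^ 2 + u ^ 2 := by
        field_simp
      have h3 : 1 ≤ (u / t) ^ 2 := one_le_pow₀ hr
      nlinarith [sq_nonneg s]
    have h4 := Real.rpow_le_rpow_of_nonpos (by positivity) h1 he
    rw [Real.mul_rpow (by positivity) (by positivity)] at h4
    have h5 : (u / t)⁻¹ ≤ ((u / t) ^ 2) ^ e := by
      rw [← Real.rpow_natCast, ← Real.rpow_mul (by positivity), ← Real.rpow_neg_one]
      exact Real.rpow_le_rpow_of_exponent_le hr (by push_cast; linarith)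
    have h6 : 0 ≤ (s ^ 2 + t ^ 2) ^ e := by positivity
    calc (s ^ 2 + t ^ 2) ^ e * t = (u / t)⁻¹ * (s ^ 2 + t ^ 2) ^ e * u := by
          field_simp
      _ ≤ ((u / t) ^ 2) ^ e * (s ^ 2 + t ^ 2) ^ e * u := by gcongr
      _ ≤ _ := by gcongr

lemma norm_Vsp_aux {k : ℕ} (s p : ℝ) (z : EuclideanSpace ℝ (Fin k)) :
    ‖Vsp s p z‖ = (s ^ 2 + ‖z‖ ^ 2) ^ ((p - 2) / 4) * ‖z‖ := by
  rw [Vsp, norm_smul, Real.norm_of_nonneg (by positivity)]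

/-- For `p ∈ (1,2)` there is `c = c(p) ≥ 1` such that for all `s ≥ 0`, `k ≥ 1` and
`z₁, z₂ ∈ ℝᵏ`, `|V_{s,p}(z₁ + z₂)| ≤ c (|V_{s,p}(z₁)| + |V_{s,p}(z₂)|)`. -/
theorem Vsp_subadditive (p : ℝ) (hp : 1 < p) (hp2 : p < 2) :
    ∃ c : ℝ, 1 ≤ c ∧
      ∀ (s : ℝ), 0 ≤ s → ∀ (k : ℕ), 1 ≤ k →
        ∀ z₁ z₂ : EuclideanSpace ℝ (Fin k),
          ‖Vsp s p (z₁ + z₂)‖ ≤ c * (‖Vsp s p z₁‖ + ‖Vsp s p z₂‖) := by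
  refine ⟨1, le_rfl, fun s _ k _ z₁ z₂ => ?_⟩
  simp only [norm_Vsp_aux, one_mul]
  have he : (p - 2) / 4 ≤ 0 := by linarith
  have h0 := aux_mono s ((p - 2) / 4) _ _ he (by linarith) (norm_nonneg _) (norm_add_le z₁ z₂)
  have h1 := aux_anti s ((p - 2) / 4) ‖z₁‖ (‖z₁‖ + ‖z₂‖) he (norm_nonneg _)
    (by linarith [norm_nonneg z₂])
  have h2 := aux_anti s ((p - 2) / 4) ‖z₂‖ (‖z₁‖ + ‖z₂‖) he (norm_nonneg _)
    (by linarith [norm_nonneg z₁])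
  rw [mul_add] at h0
  linarith
end

section
/- Let p ∈ (1,2), s ≥ 0 and k ≥ 1. Then there exists a constant c ≥ 1, depending only on p, such that for all z₁, z₂ ∈ ℝᵏ with s + |z₁| + |z₂| > 0 one has |z₁ − z₂|^p ≤ c |V_{s,p}(z₁) − V_{s,p}(z₂)|² + c |V_{s,p}(z₁) − V_{s,p}(z₂)|^p (|z₁| + s)^{p(2−p)/2}. -/
lemma Vaux_radial (a s x y : ℝ) (ha : 0 < a) (ha4 : a < 1/4) (hx : 0 ≤ x)
    (hxy : x ≤ y) :
    (s^2 + x^2) ^ (-a) * x ≤ (s^2 + y^2) ^ (-a) * (2*a*y + (1-2*a)*x) := by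
  have hy : 0 ≤ y := hx.trans hxy
  rcases hx.eq_or_lt with h0 | hx0
  · rw [← h0]
    have : 0 ≤ (s^2 + y^2) ^ (-a) := by positivity
    simp only [mul_zero, add_zero]
    positivity
  have hy0 : 0 < y := hx0.trans_le hxy
  have hA : 0 < s^2 + x^2 := by positivity
  have hB : 0 < s^2 + y^2 := by positivity
  have h1 : y ^ (2*a) * x ^ (1-2*a) ≤ 2*a*y + (1-2*a)*x :=
    Real.geom_mean_le_arith_mean2_weighted (by linarith) (by linarith) hy hx (by ring)
  have h2 : (s^2+y^2)^a * x^(2*a) ≤ (s^2+x^2)^a * y^(2*a) := by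
    have e : ∀ t : ℝ, 0 ≤ t → t ^ (2*a) = (t^2)^a := fun t ht => by
      rw [Real.rpow_mul ht]; norm_num
    rw [e x hx, e y hy, ← Real.mul_rpow hB.le (by positivity),
      ← Real.mul_rpow hA.le (by positivity)]
    apply Real.rpow_le_rpow (by positivity) _ ha.le
    have : x^2 ≤ y^2 := by gcongr
    nlinarith [mul_le_mul_of_nonneg_left this (sq_nonneg s)]
  have h3 : x ^ (2*a) * x^(1-2*a) = x := by
    rw [← Real.rpow_add hx0]; simp
  have h4 : (s^2+y^2)^a * x ≤ (s^2+x^2)^a * (2*a*y + (1-2*a)*x) := by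
    calc (s^2+y^2)^a * x = ((s^2+y^2)^a * x^(2*a)) * x^(1-2*a) := by rw [mul_assoc, h3]
      _ ≤ ((s^2+x^2)^a * y^(2*a)) * x^(1-2*a) := by gcongr
      _ = (s^2+x^2)^a * (y^(2*a) * x^(1-2*a)) := by ring
      _ ≤ _ := by gcongr
  have hAa : 0 < (s^2+x^2)^a := by positivity
  have hBa : 0 < (s^2+y^2)^a := by positivity
  rw [Real.rpow_neg hA.le, Real.rpow_neg hB.le, inv_mul_eq_div, inv_mul_eq_div,
    div_le_div_iff₀ hAa hBa]
  linarith

lemma Vaux_key {k : ℕ} (p s : ℝ) (hp : 1 < p) (hp2 : p < 2)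
    (z₁ z₂ : EuclideanSpace ℝ (Fin k)) (h : ‖z₁‖ ≤ ‖z₂‖) (h2 : 0 < s^2 + ‖z₂‖^2) :
    ‖z₁ - z₂‖ ≤ 2 * ‖Vsp s p z₁ - Vsp s p z₂‖ * (s^2 + ‖z₂‖^2) ^ ((2-p)/4) := by
  have hr := Vaux_radial ((2-p)/4) s ‖z₁‖ ‖z₂‖ (by linarith) (by linarith) (norm_nonneg _) h
  have ee : (p-2)/4 = -((2-p)/4) := by ring
  unfold Vsp
  rw [ee]
  set a := (2-p)/4 with ha
  by_cases hz : z₁ = 0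
  · subst hz
    simp only [smul_zero, zero_sub, norm_neg, norm_smul]
    rw [Real.norm_of_nonneg (by positivity), Real.rpow_neg h2.le]
    have : 0 < (s^2 + ‖z₂‖^2) ^ a := by positivity
    field_simp
    nlinarith [norm_nonneg z₂]
  have hx0 : 0 < ‖z₁‖ := norm_pos_iff.mpr hz
  have hA : 0 < s^2 + ‖z₁‖^2 := by positivity
  have hw : (s^2 + ‖z₂‖^2) ^ (-a) ≤ (s^2 + ‖z₁‖^2) ^ (-a) := by
    apply Real.rpow_le_rpow_of_nonpos hA _ (by linarith)
    gcongr
  have hM : (s^2 + ‖z₂‖^2) ^ (-a) * (s^2 + ‖z₂‖^2) ^ a = 1 := by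
    rw [← Real.rpow_add h2]; simp
  have hv0 : 0 < (s^2 + ‖z₂‖^2) ^ (-a) := by positivity
  have hm0 : 0 < (s^2 + ‖z₂‖^2) ^ a := by positivity
  set v := (s^2 + ‖z₂‖^2) ^ (-a)
  set w := (s^2 + ‖z₁‖^2) ^ (-a)
  set m := (s^2 + ‖z₂‖^2) ^ a
  have key : v * ‖z₁ - z₂‖ ≤ 2 * ‖w • z₁ - v • z₂‖ := by
    refine (sq_le_sq₀ (by positivity) (by positivity)).mp ?_
    rw [mul_pow, mul_pow, @norm_sub_sq_real, @norm_sub_sq_real, norm_smul, norm_smul,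
      real_inner_smul_left, real_inner_smul_right,
      Real.norm_of_nonneg hv0.le, Real.norm_of_nonneg (hv0.le.trans hw)]
    have hi := real_inner_le_norm z₁ z₂
    set i := inner ℝ z₁ z₂
    set x := ‖z₁‖
    set y := ‖z₂‖
    have r1 : v * (y - x) ≤ 2 * (v*y - w*x) := by
      have : 0 ≤ v * (y-x) := mul_nonneg hv0.le (by linarith)
      have a4 : a < 1/4 := by linarith
      nlinarith
    have r2 : (v * (y - x))^2 ≤ (2 * (v*y - w*x))^2 := by
      have : 0 ≤ v * (y-x) := mul_nonneg hv0.le (by linarith)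
      gcongr
    have r3 : v*v*(x*y - i) ≤ w*v*(x*y-i) := by
      have : 0 ≤ x*y-i := by linarith
      gcongr
    have r4 : 0 ≤ v*v*(x*y - i) := by
      have : 0 ≤ x*y-i := by linarith
      positivity
    nlinarith
  calc ‖z₁ - z₂‖ = (v * ‖z₁ - z₂‖) * m := by rw [mul_right_comm, hM, one_mul]
    _ ≤ _ := by gcongr

lemma Vaux_key2 {k : ℕ} (p s : ℝ) (hp : 1 < p) (hp2 : p < 2) (hs : 0 ≤ s)
    (z₁ z₂ : EuclideanSpace ℝ (Fin k)) (h : 0 < s + ‖z₁‖ + ‖z₂‖) :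
    ‖z₁ - z₂‖ ≤ 2 * ‖Vsp s p z₁ - Vsp s p z₂‖ * (‖z₁‖ + s + ‖z₁ - z₂‖) ^ ((2-p)/2) := by
  have n1 := norm_nonneg z₁
  have n2 := norm_nonneg z₂
  have n3 := norm_nonneg (z₁ - z₂)
  have e : ∀ t : ℝ, 0 ≤ t → t ^ ((2-p)/2) = (t^2)^((2-p)/4) := fun t ht => by
    rw [show (2-p)/2 = 2 * ((2-p)/4) by ring, Real.rpow_mul ht]; norm_num
  have tri : ‖z₂‖ ≤ ‖z₁‖ + ‖z₁ - z₂‖ := by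
    have := norm_sub_le z₁ (z₁ - z₂)
    simpa using this
  rw [e _ (by positivity)]
  rcases le_total ‖z₁‖ ‖z₂‖ with h1 | h1
  · have hpos : 0 < s^2 + ‖z₂‖^2 := by
      rcases hs.eq_or_lt with h0 | h0
      · have : 0 < ‖z₂‖ := by linarith
        positivity
      · positivity
    refine (Vaux_key p s hp hp2 z₁ z₂ h1 hpos).trans ?_
    refine mul_le_mul_of_nonneg_left ?_ (by positivity)
    apply Real.rpow_le_rpow (by positivity) _ (by linarith)
    nlinarith
  · have hpos : 0 < s^2 + ‖z₁‖^2 := by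
      rcases hs.eq_or_lt with h0 | h0
      · have : 0 < ‖z₁‖ := by linarith
        positivity
      · positivity
    have := Vaux_key p s hp hp2 z₂ z₁ h1 hpos
    rw [norm_sub_rev z₂, norm_sub_rev (Vsp s p z₂)] at this
    refine this.trans ?_
    refine mul_le_mul_of_nonneg_left ?_ (by positivity)
    apply Real.rpow_le_rpow (by positivity) _ (by linarith)
    nlinarith [mul_nonneg n1 hs, mul_nonneg n1 n3, mul_nonneg hs n3]

lemma Vaux_final (p D W R : ℝ) (hp : 1 < p) (hp2 : p < 2) (hD : 0 ≤ D) (hW : 0 ≤ W) (hR : 0 ≤ R)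
    (h : D ≤ 2 * W * (R + D) ^ ((2-p)/2)) :
    D ^ p ≤ 16 * W ^ 2 + 16 * W ^ p * R ^ (p * (2 - p) / 2) := by
  have two : ∀ T : ℝ, 0 ≤ T → (2*T)^((2-p)/2) ≤ 2 * T^((2-p)/2) := fun T hT => by
    rw [Real.mul_rpow (by norm_num) hT]
    have : (2:ℝ)^((2-p)/2) ≤ 2^(1:ℝ) := by
      apply Real.rpow_le_rpow_of_exponent_le <;> linarith
    rw [Real.rpow_one] at this
    gcongr
  have big : ∀ T : ℝ, 0 ≤ T → R + D ≤ 2 * T → D ≤ 4 * W * T^((2-p)/2) := fun T hT hh => by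
    calc D ≤ 2 * W * (R + D) ^ ((2-p)/2) := h
      _ ≤ 2 * W * (2 * T)^((2-p)/2) := by
        have : 0 ≤ (2-p)/2 := by linarith
        gcongr
      _ ≤ 2 * W * (2 * T^((2-p)/2)) := by gcongr; exact two T hT
      _ = _ := by ring
  rcases le_total D R with hc | hc
  · have h1 := big R hR (by linarith)
    have h2 : D^p ≤ (4 * W * R^((2-p)/2))^p := Real.rpow_le_rpow hD h1 (by linarith)
    rw [Real.mul_rpow (by positivity) (by positivity), Real.mul_rpow (by norm_num) hW,
      ← Real.rpow_mul hR, show (2-p)/2*p = p*(2-p)/2 by ring] at h2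
    have h4 : (4:ℝ)^p ≤ 16 := by
      have : (4:ℝ)^p ≤ 4^(2:ℝ) := by
        apply Real.rpow_le_rpow_of_exponent_le <;> linarith
      norm_num at this
      exact this
    have h5 : (4:ℝ)^p * W^p * R^(p*(2-p)/2) ≤ 16 * W^p * R^(p*(2-p)/2) := by gcongr
    nlinarith [sq_nonneg W]
  · have h1 := big D hD (by linarith)
    have h0 : 0 ≤ 16 * W ^ p * R ^ (p * (2 - p) / 2) := by positivity
    rcases hD.eq_or_lt with hd | hd
    · rw [← hd, Real.zero_rpow (by linarith)]
      positivity
    have h2 : D^(p/2) ≤ 4 * W := by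
      have hq : 0 < D^((2-p)/2) := by positivity
      have : D^(p/2) * D^((2-p)/2) = D := by
        rw [← Real.rpow_add hd, show p/2 + (2-p)/2 = 1 by ring, Real.rpow_one]
      exact le_of_mul_le_mul_right (this.trans_le h1) hq
    have h3 : D^p = (D^(p/2))^2 := by
      rw [sq, ← Real.rpow_add hd]; congr 1; ring
    have h6 : (D^(p/2))^2 ≤ (4*W)^2 := by gcongr
    nlinarith


/-- For `p ∈ (1,2)` there is `c = c(p) ≥ 1` such that for all `s ≥ 0`, `k ≥ 1` and
`z₁, z₂ ∈ ℝᵏ` with `s + |z₁| + |z₂| > 0`,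
`|z₁ − z₂|^p ≤ c |V_{s,p}(z₁) − V_{s,p}(z₂)|² + c |V_{s,p}(z₁) − V_{s,p}(z₂)|^p (|z₁| + s)^{p(2−p)/2}`. -/
theorem Vsp_pth_power_bound (p : ℝ) (hp : 1 < p) (hp2 : p < 2) :
    ∃ c : ℝ, 1 ≤ c ∧
      ∀ (s : ℝ), 0 ≤ s → ∀ (k : ℕ), 1 ≤ k →
        ∀ z₁ z₂ : EuclideanSpace ℝ (Fin k), 0 < s + ‖z₁‖ + ‖z₂‖ →
          ‖z₁ - z₂‖ ^ p ≤
            c * ‖Vsp s p z₁ - Vsp s p z₂‖ ^ 2 +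
              c * ‖Vsp s p z₁ - Vsp s p z₂‖ ^ p * (‖z₁‖ + s) ^ (p * (2 - p) / 2) := by

  refine ⟨16, by norm_num, fun s hs k _ z₁ z₂ h => ?_⟩
  exact Vaux_final p _ _ _ hp hp2 (norm_nonneg _) (norm_nonneg _) (by positivity)
    (Vaux_key2 p s hp hp2 hs z₁ z₂ h)
end

section
/- Let p ∈ (1,2) and k ≥ 1. Then there exists a constant c ≥ 1, depending only on p, such that for all z₁, z₂ ∈ ℝᵏ with |z₁| + |z₂| > 0 one has c⁻¹ |V_p(z₁) − V_p(z₂)| ≤ |V_{|z₁|,p}(z₂ − z₁)| ≤ c |V_p(z₁) − V_p(z₂)|, where V_{|z₁|,p}(z₂ − z₁) = (|z₁|² + |z₂ − z₁|²)^{(p−2)/4} (z₂ − z₁) and V_p(z) = |z|^{(p−2)/2} z. -/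
lemma aux_vec {E : Type*} [NormedAddCommGroup E] [InnerProductSpace ℝ E] (x y : E) (α β : ℝ)
    (hβ : 0 ≤ β) (hαβ : β ≤ α) (hab : ‖x‖ ≤ ‖y‖) (h : α * ‖x‖ ≤ β * ((‖x‖ + ‖y‖) / 2)) :
    β * ‖x - y‖ / 2 ≤ ‖α • x - β • y‖ ∧ ‖α • x - β • y‖ ≤ 2 * (β * ‖x - y‖) := by
  have htri : ‖y‖ - ‖x‖ ≤ ‖x - y‖ := by
    rw [norm_sub_rev]; exact norm_sub_norm_le y x
  have hx := norm_nonneg x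
  have hd := norm_nonneg (x - y)
  constructor
  · refine (pow_le_pow_iff_left₀ (by positivity) (norm_nonneg _) two_ne_zero).1 ?_
    have h1 : ‖α • x - β • y‖ ^ 2 =
        (β * ‖y‖ - α * ‖x‖) ^ 2 + α * β * (‖x - y‖ ^ 2 - (‖y‖ - ‖x‖) ^ 2) := by
      rw [norm_sub_sq_real, norm_sub_sq_real, norm_smul, norm_smul, inner_smul_left,
        inner_smul_right, Real.norm_of_nonneg hβ, Real.norm_of_nonneg (hβ.trans hαβ)]
      simp only [conj_trivial]
      ring
    rw [h1]
    have h2 : (β * (‖y‖ - ‖x‖) / 2) ^ 2 ≤ (β * ‖y‖ - α * ‖x‖) ^ 2 := by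
      apply pow_le_pow_left₀
      · have := mul_nonneg hβ (sub_nonneg.2 hab); linarith
      · nlinarith
    have h3 : 0 ≤ ‖x - y‖ ^ 2 - (‖y‖ - ‖x‖) ^ 2 := by
      have := pow_le_pow_left₀ (sub_nonneg.2 hab) htri 2
      linarith
    have h4 : β * β * (‖x - y‖ ^ 2 - (‖y‖ - ‖x‖) ^ 2) ≤
        α * β * (‖x - y‖ ^ 2 - (‖y‖ - ‖x‖) ^ 2) := by gcongr
    have h5 := mul_nonneg (mul_nonneg hβ hβ) h3
    nlinarith
  · have e : α • x - β • y = β • (x - y) + (α - β) • x := by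
      rw [smul_sub, sub_smul]; abel
    rw [e]
    refine (norm_add_le _ _).trans ?_
    rw [norm_smul, norm_smul, Real.norm_of_nonneg hβ, Real.norm_of_nonneg (sub_nonneg.2 hαβ)]
    have := mul_le_mul_of_nonneg_left htri hβ
    have := mul_le_mul_of_nonneg_left hab hβ
    nlinarith

lemma aux_pow (a b r : ℝ) (ha : 0 < a) (hab : a ≤ b) (hr : -(1/4) ≤ r) (hr0 : r ≤ 0) :
    (b ^ 2) ^ r ≤ (a ^ 2) ^ r ∧ (a ^ 2) ^ r * a ≤ (b ^ 2) ^ r * ((a + b) / 2) := by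
  have hb : 0 < b := ha.trans_le hab
  constructor
  · exact Real.rpow_le_rpow_of_nonpos (by positivity) (by gcongr) hr0
  · have hba : 1 ≤ b / a := (one_le_div ha).2 hab
    have key : (a ^ 2) ^ r = (b ^ 2) ^ r * ((b / a) ^ 2) ^ (-r) := by
      rw [div_pow, Real.div_rpow (by positivity) (by positivity), Real.rpow_neg (by positivity),
        Real.rpow_neg (by positivity)]
      have : (b ^ 2) ^ r ≠ 0 := by positivity
      have : (a ^ 2) ^ r ≠ 0 := by positivity
      field_simp
    have h1 : ((b / a) ^ 2) ^ (-r) ≤ (1 + b / a) / 2 := by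
      calc ((b / a) ^ 2) ^ (-r) ≤ ((b / a) ^ 2) ^ (1/4 : ℝ) :=
            Real.rpow_le_rpow_of_exponent_le (one_le_pow₀ hba) (by linarith)
        _ = √(b / a) := by
            rw [← Real.rpow_natCast, ← Real.rpow_mul (by positivity), Real.sqrt_eq_rpow]
            norm_num
        _ ≤ _ := by
            have := Real.sq_sqrt (show 0 ≤ b / a by positivity)
            nlinarith [sq_nonneg (√(b / a) - 1)]
    rw [key, mul_assoc]
    gcongr
    calc ((b / a) ^ 2) ^ (-r) * a ≤ (1 + b / a) / 2 * a := by gcongr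
      _ = _ := by field_simp

lemma aux_main {E : Type*} [NormedAddCommGroup E] [InnerProductSpace ℝ E] (x y : E) (r : ℝ)
    (hab : ‖x‖ ≤ ‖y‖) (hr : -(1/4) ≤ r) (hr0 : r ≤ 0) :
    (‖y‖ ^ 2) ^ r * ‖x - y‖ / 2 ≤ ‖(‖x‖ ^ 2) ^ r • x - (‖y‖ ^ 2) ^ r • y‖ ∧
    ‖(‖x‖ ^ 2) ^ r • x - (‖y‖ ^ 2) ^ r • y‖ ≤ 2 * ((‖y‖ ^ 2) ^ r * ‖x - y‖) := by
  have hβ : 0 ≤ (‖y‖ ^ 2) ^ r := by positivity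
  rcases eq_or_ne x 0 with rfl | hx
  · have := aux_vec (0 : E) y ((‖y‖ ^ 2) ^ r) ((‖y‖ ^ 2) ^ r) hβ le_rfl hab
      (by rw [norm_zero, mul_zero]; positivity)
    simpa only [smul_zero] using this
  · obtain ⟨h1, h2⟩ := aux_pow ‖x‖ ‖y‖ r (norm_pos_iff.2 hx) hab hr hr0
    exact aux_vec x y _ _ hβ h1 hab h2

lemma aux_shift (a d M r : ℝ) (hM : 0 < M) (hr : -1 ≤ r) (hr0 : r ≤ 0)
    (h1 : a ^ 2 + d ^ 2 ≤ 5 * M ^ 2) (h2 : M ^ 2 / 2 ≤ a ^ 2 + d ^ 2) :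
    (M ^ 2) ^ r / 5 ≤ (a ^ 2 + d ^ 2) ^ r ∧ (a ^ 2 + d ^ 2) ^ r ≤ 2 * (M ^ 2) ^ r := by
  have hM2 : 0 < M ^ 2 / 2 := by positivity
  constructor
  · refine le_trans ?_ (Real.rpow_le_rpow_of_nonpos (hM2.trans_le h2) h1 hr0)
    rw [Real.mul_rpow (by norm_num) (by positivity), div_eq_inv_mul]
    gcongr
    rw [← Real.rpow_neg_one]
    exact Real.rpow_le_rpow_of_exponent_le (by norm_num) hr
  · refine (Real.rpow_le_rpow_of_nonpos hM2 h2 hr0).trans ?_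
    rw [Real.div_rpow (by positivity) (by norm_num), div_eq_inv_mul, ← Real.rpow_neg (by norm_num)]
    gcongr
    calc (2:ℝ) ^ (-r) ≤ 2 ^ (1:ℝ) := Real.rpow_le_rpow_of_exponent_le (by norm_num) (by linarith)
      _ = 2 := by norm_num

/-- For `p ∈ (1,2)` there is `c = c(p) ≥ 1` such that for all `k ≥ 1` and
`z₁, z₂ ∈ ℝᵏ` with `|z₁| + |z₂| > 0`,
`|V_{|z₁|,p}(z₂ − z₁)| ≈ |V_p(z₁) − V_p(z₂)|`. -/
theorem Vsp_shift_equiv (p : ℝ) (hp : 1 < p) (hp2 : p < 2) :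
    ∃ c : ℝ, 1 ≤ c ∧
      ∀ (k : ℕ), 1 ≤ k →
        ∀ z₁ z₂ : EuclideanSpace ℝ (Fin k), 0 < ‖z₁‖ + ‖z₂‖ →
          c⁻¹ * ‖Vsp 0 p z₁ - Vsp 0 p z₂‖ ≤ ‖Vsp ‖z₁‖ p (z₂ - z₁)‖ ∧
            ‖Vsp ‖z₁‖ p (z₂ - z₁)‖ ≤ c * ‖Vsp 0 p z₁ - Vsp 0 p z₂‖ := by
  refine ⟨10, by norm_num, fun k _ x y hxy => ?_⟩
  have hr : -(1/4) ≤ (p - 2) / 4 := by linarith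
  have hr0 : (p - 2) / 4 ≤ 0 := by linarith
  unfold Vsp
  generalize (p - 2) / 4 = r at hr hr0
  simp only [ne_eq, OfNat.ofNat_ne_zero, not_false_eq_true, zero_pow, zero_add]
  rw [norm_smul _ (y - x), Real.norm_of_nonneg (by positivity), norm_sub_rev y x]
  have hx := norm_nonneg x
  have hy := norm_nonneg y
  have hd := norm_nonneg (x - y)
  have t1 : ‖x - y‖ ≤ ‖x‖ + ‖y‖ := norm_sub_le x y
  have t2 : ‖y‖ - ‖x‖ ≤ ‖x - y‖ := by
    rw [norm_sub_rev]; exact norm_sub_norm_le y x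
  obtain ⟨M, hM, hxM, hyM, hMd, m1, m2⟩ : ∃ M : ℝ, 0 < M ∧ ‖x‖ ≤ M ∧ ‖y‖ ≤ M ∧
      M ≤ ‖x‖ + ‖x - y‖ ∧
      (M ^ 2) ^ r * ‖x - y‖ / 2 ≤ ‖(‖x‖ ^ 2) ^ r • x - (‖y‖ ^ 2) ^ r • y‖ ∧
      ‖(‖x‖ ^ 2) ^ r • x - (‖y‖ ^ 2) ^ r • y‖ ≤ 2 * ((M ^ 2) ^ r * ‖x - y‖) := by
    rcases le_total ‖x‖ ‖y‖ with h | h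
    · exact ⟨‖y‖, by linarith, h, le_rfl, by linarith, aux_main x y r h hr hr0⟩
    · refine ⟨‖x‖, by linarith, le_rfl, h, by linarith, ?_⟩
      have := aux_main y x r h hr hr0
      rwa [norm_sub_rev y x, norm_sub_rev (_ • y)] at this
  obtain ⟨s1, s2⟩ := aux_shift ‖x‖ ‖x - y‖ M r hM (by linarith) hr0 (by nlinarith)
    (by nlinarith [sq_nonneg (‖x‖ - ‖x - y‖)])
  have u1 := mul_le_mul_of_nonneg_right s1 hd
  have u2 := mul_le_mul_of_nonneg_right s2 hd
  have u3 : 0 ≤ (M ^ 2) ^ r * ‖x - y‖ := by positivity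
  constructor <;> linarith
end

section
/- Let p ∈ (1,2), s ≥ 0 and k ≥ 1. Then there exists a constant c ≥ 1, depending only on p, such that for all z₁, z₂ ∈ ℝᵏ with z₁ ≠ 0 one has |V_{s,p}(z₁)|² |z₂| / |z₁| ≤ c (|V_{s,p}(z₁)|² + |V_{s,p}(z₂)|²). -/
theorem aux_mono_s9 (q s a b : ℝ) (hq : -(1/2) ≤ q) (ha : 0 < a) (hab : a ≤ b) :
    (s ^ 2 + a ^ 2) ^ q * a ≤ (s ^ 2 + b ^ 2) ^ q * b := by
  have hb : 0 < b := ha.trans_le hab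
  have hA : 0 < s ^ 2 + a ^ 2 := by positivity
  have hB : 0 < s ^ 2 + b ^ 2 := by positivity
  have hsq : a ^ 2 ≤ b ^ 2 := by gcongr
  have e : q = (q + 1/2) + -(1/2) := by ring
  rw [e, Real.rpow_add hA, Real.rpow_add hB, mul_assoc, mul_assoc]
  have h1 : (s ^ 2 + a ^ 2) ^ (q + 1/2) ≤ (s ^ 2 + b ^ 2) ^ (q + 1/2) :=
    Real.rpow_le_rpow hA.le (by linarith) (by linarith)
  have h2 : (s ^ 2 + a ^ 2) ^ (-(1/2) : ℝ) * a ≤ (s ^ 2 + b ^ 2) ^ (-(1/2) : ℝ) * b := by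
    rw [Real.rpow_neg hA.le, Real.rpow_neg hB.le, ← Real.sqrt_eq_rpow, ← Real.sqrt_eq_rpow,
      inv_mul_eq_div, inv_mul_eq_div,
      div_le_div_iff₀ (Real.sqrt_pos.2 hA) (Real.sqrt_pos.2 hB)]
    refine (sq_le_sq₀ (by positivity) (by positivity)).1 ?_
    · rw [mul_pow, mul_pow, Real.sq_sqrt hA.le, Real.sq_sqrt hB.le]
      nlinarith [mul_le_mul_of_nonneg_left hsq (sq_nonneg s)]
  exact mul_le_mul h1 h2 (by positivity) (by positivity)

theorem aux_norm {k : ℕ} (s p : ℝ) (z : EuclideanSpace ℝ (Fin k)) :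
    ‖Vsp s p z‖ ^ 2 = (s ^ 2 + ‖z‖ ^ 2) ^ ((p - 2) / 2) * ‖z‖ ^ 2 := by
  have h : 0 ≤ s ^ 2 + ‖z‖ ^ 2 := by positivity
  rw [Vsp, norm_smul, mul_pow, Real.norm_of_nonneg (by positivity), ← Real.rpow_mul_natCast h]
  congr 2
  push_cast
  ring

/-- For `p ∈ (1,2)` there is `c = c(p) ≥ 1` such that for all `s ≥ 0`, `k ≥ 1` and
`z₁, z₂ ∈ ℝᵏ` with `z₁ ≠ 0`,
`|V_{s,p}(z₁)|² |z₂| / |z₁| ≤ c (|V_{s,p}(z₁)|² + |V_{s,p}(z₂)|²)`. -/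
theorem Vsp_ratio_bound (p : ℝ) (hp : 1 < p) (hp2 : p < 2) :
    ∃ c : ℝ, 1 ≤ c ∧
      ∀ (s : ℝ), 0 ≤ s → ∀ (k : ℕ), 1 ≤ k →
        ∀ z₁ z₂ : EuclideanSpace ℝ (Fin k), z₁ ≠ 0 →
          ‖Vsp s p z₁‖ ^ 2 * ‖z₂‖ / ‖z₁‖ ≤ c * (‖Vsp s p z₁‖ ^ 2 + ‖Vsp s p z₂‖ ^ 2) := by
  refine ⟨1, le_rfl, fun s _ k _ z₁ z₂ hz => ?_⟩
  have ha : 0 < ‖z₁‖ := norm_pos_iff.2 hz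
  rw [one_mul]
  rcases le_total ‖z₂‖ ‖z₁‖ with h | h
  · rw [div_le_iff₀ ha]
    have := mul_le_mul_of_nonneg_left h (sq_nonneg ‖Vsp s p z₁‖)
    nlinarith [mul_nonneg (sq_nonneg ‖Vsp s p z₂‖) ha.le]
  · have key := aux_mono_s9 ((p - 2) / 2) s ‖z₁‖ ‖z₂‖ (by linarith) ha h
    have h2 : ‖Vsp s p z₁‖ ^ 2 * ‖z₂‖ / ‖z₁‖ ≤ ‖Vsp s p z₂‖ ^ 2 := by
      rw [aux_norm, aux_norm, div_le_iff₀ ha]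
      have := mul_le_mul_of_nonneg_right key (mul_nonneg ha.le (norm_nonneg z₂))
      nlinarith
    linarith [sq_nonneg ‖Vsp s p z₁‖]
end

section
/- Let p ∈ (1,2), s ≥ 0 and k ≥ 1. Then there exists a constant c ≥ 1, depending only on p, such that for all z₁, z₂ ∈ ℝᵏ with z₁ ≠ 0, z₂ ≠ 0 and z₁ + z₂ ≠ 0 one has |V_{s,p}(z₁ + z₂)|² / |z₁ + z₂| ≤ c (|V_{s,p}(z₁)|² / |z₁| + |V_{s,p}(z₂)|² / |z₂|). -/
theorem Vsp_aux_mono (p s t u : ℝ) (hp : 1 < p) (ht : 0 < t) (htu : t ≤ u) :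
    (s ^ 2 + t ^ 2) ^ ((p - 2) / 2) * t ≤ (s ^ 2 + u ^ 2) ^ ((p - 2) / 2) * u := by
  have hu : 0 < u := lt_of_lt_of_le ht htu
  have hA : 0 < s ^ 2 + t ^ 2 := by positivity
  have hB : 0 < s ^ 2 + u ^ 2 := by positivity
  have hsq : t ^ 2 ≤ u ^ 2 := by gcongr
  have key : ∀ A : ℝ, 0 < A → A ^ ((p - 2) / 2) = A ^ ((p - 1) / 2) / √A := by
    intro A hA
    rw [Real.sqrt_eq_rpow, ← Real.rpow_sub hA]
    congr 1
    ring
  have h1 : t / √(s ^ 2 + t ^ 2) ≤ u / √(s ^ 2 + u ^ 2) := by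
    rw [div_le_div_iff₀ (Real.sqrt_pos.2 hA) (Real.sqrt_pos.2 hB)]
    apply le_of_sq_le_sq _ (by positivity)
    rw [mul_pow, mul_pow, Real.sq_sqrt hA.le, Real.sq_sqrt hB.le]
    nlinarith [mul_le_mul_of_nonneg_left hsq (sq_nonneg s)]
  have h2 : (s ^ 2 + t ^ 2) ^ ((p - 1) / 2) ≤ (s ^ 2 + u ^ 2) ^ ((p - 1) / 2) :=
    Real.rpow_le_rpow hA.le (by linarith) (by linarith)
  rw [key _ hA, key _ hB, div_mul_eq_mul_div, div_mul_eq_mul_div, mul_div_assoc, mul_div_assoc]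
  exact mul_le_mul h2 h1 (by positivity) (by positivity)

theorem Vsp_aux_norm {k : ℕ} (s p : ℝ) (z : EuclideanSpace ℝ (Fin k)) (hz : z ≠ 0) :
    ‖Vsp s p z‖ ^ 2 / ‖z‖ = (s ^ 2 + ‖z‖ ^ 2) ^ ((p - 2) / 2) * ‖z‖ := by
  have hn : 0 < ‖z‖ := norm_pos_iff.2 hz
  have hA : 0 < s ^ 2 + ‖z‖ ^ 2 := by positivity
  have h : (s ^ 2 + ‖z‖ ^ 2) ^ ((p - 2) / 2)
      = (s ^ 2 + ‖z‖ ^ 2) ^ ((p - 2) / 4) * (s ^ 2 + ‖z‖ ^ 2) ^ ((p - 2) / 4) := by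
    rw [← Real.rpow_add hA]
    congr 1
    ring
  rw [Vsp, norm_smul, Real.norm_of_nonneg (Real.rpow_nonneg hA.le _), h]
  field_simp

/-- For `p ∈ (1,2)` there is `c = c(p) ≥ 1` such that for all `s ≥ 0`, `k ≥ 1` and
nonzero `z₁, z₂, z₁ + z₂ ∈ ℝᵏ`,
`|V_{s,p}(z₁+z₂)|²/|z₁+z₂| ≤ c (|V_{s,p}(z₁)|²/|z₁| + |V_{s,p}(z₂)|²/|z₂|)`. -/
theorem Vsp_sum_ratio_bound (p : ℝ) (hp : 1 < p) (hp2 : p < 2) :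
    ∃ c : ℝ, 1 ≤ c ∧
      ∀ (s : ℝ), 0 ≤ s → ∀ (k : ℕ), 1 ≤ k →
        ∀ z₁ z₂ : EuclideanSpace ℝ (Fin k), z₁ ≠ 0 → z₂ ≠ 0 → z₁ + z₂ ≠ 0 →
          ‖Vsp s p (z₁ + z₂)‖ ^ 2 / ‖z₁ + z₂‖ ≤
            c * (‖Vsp s p z₁‖ ^ 2 / ‖z₁‖ + ‖Vsp s p z₂‖ ^ 2 / ‖z₂‖) := by
  refine ⟨1, le_refl _, ?_⟩
  intro s hs k hk z₁ z₂ h₁ h₂ h₁₂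
  rw [Vsp_aux_norm s p _ h₁, Vsp_aux_norm s p _ h₂, Vsp_aux_norm s p _ h₁₂, one_mul]
  have n₁ : 0 < ‖z₁‖ := norm_pos_iff.2 h₁
  have n₂ : 0 < ‖z₂‖ := norm_pos_iff.2 h₂
  refine (Vsp_aux_mono p s _ _ hp (norm_pos_iff.2 h₁₂) (norm_add_le z₁ z₂)).trans ?_
  rw [mul_add]
  have e : (p - 2) / 2 ≤ 0 := by linarith
  refine add_le_add (mul_le_mul_of_nonneg_right ?_ n₁.le) (mul_le_mul_of_nonneg_right ?_ n₂.le)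
  · exact Real.rpow_le_rpow_of_nonpos (by positivity) (by nlinarith) e
  · exact Real.rpow_le_rpow_of_nonpos (by positivity) (by nlinarith) e
end

section
/- Let 1 < p < 2 and let B ⊂ ℝⁿ be a ball. Then there exists a constant c ≥ 1, depending only on n, N and p, such that for every measurable map g : ℝⁿ → ℝ^{N×n} with |g|^p integrable on B one has c⁻¹ 𝔉(g;B) ≤ (⨍_B |V_p(g) − V_p((g)_B)|² dx)^{1/2} ≤ c 𝔉(g;B), where (g)_B = ⨍_B g dx. -/
open MeasureTheory

/-- `V_p(z) := |z|^{(p−2)/2} z` on the (Euclidean) space `ℝ^{N×n}` (with `V_p(0)=0`). -/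
noncomputable def Vp {ι : Type*} [Fintype ι] (p : ℝ) (z : EuclideanSpace ℝ ι) :
    EuclideanSpace ℝ ι :=
  (‖z‖ ^ ((p - 2) / 2)) • z

/-- The excess functional `𝔉(g;B) := (⨍_B |V_p(g) − (V_p(g))_B|² dx)^{1/2}`. -/
noncomputable def excess {n : ℕ} {ι : Type*} [Fintype ι] (p : ℝ)
    (g : EuclideanSpace ℝ (Fin n) → EuclideanSpace ℝ ι)
    (B : Set (EuclideanSpace ℝ (Fin n))) : ℝ :=
  (⨍ x in B, ‖Vp p (g x) - ⨍ y in B, Vp p (g y) ∂volume‖ ^ 2 ∂volume) ^ (1 / 2 : ℝ)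

lemma Vp_norm {ι : Type*} [Fintype ι] {p : ℝ} (hp : 1 < p) (z : EuclideanSpace ℝ ι) :
    ‖Vp p z‖ = ‖z‖ ^ (p / 2) := by
  unfold Vp
  rw [norm_smul, Real.norm_of_nonneg (by positivity)]
  rcases (norm_nonneg z).eq_or_lt with h | h
  · rw [← h, Real.zero_rpow (x := p / 2) (by linarith)]; simp
  · nth_rewrite 2 [← Real.rpow_one ‖z‖]
    rw [← Real.rpow_add h]; congr 1; ring

lemma Vp_surj {ι : Type*} [Fintype ι] {p : ℝ} (hp : 1 < p) (y : EuclideanSpace ℝ ι) :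
    ∃ a, Vp p a = y := by
  rcases eq_or_ne y 0 with rfl | hy
  · exact ⟨0, by simp [Vp]⟩
  have h : 0 < ‖y‖ := norm_pos_iff.2 hy
  refine ⟨(‖y‖ ^ (2 / p - 1)) • y, ?_⟩
  unfold Vp
  rw [norm_smul, Real.norm_of_nonneg (by positivity), smul_smul]
  have e1 : ‖y‖ ^ (2 / p - 1) * ‖y‖ = ‖y‖ ^ (2 / p) := by
    nth_rewrite 2 [← Real.rpow_one ‖y‖]
    rw [← Real.rpow_add h]; congr 1; ring
  rw [e1, ← Real.rpow_mul h.le, ← Real.rpow_add h]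
  have : 2 / p * ((p - 2) / 2) + (2 / p - 1) = 0 := by field_simp; ring
  rw [this]; simp

lemma scal_lower {r s α : ℝ} (hr : 0 < r) (hs : 0 ≤ s) (hα : -(1/2) < α) (hα0 : α < 0) (h : s ≤ r) :
    (1/2) * r ^ α * (r - s) ≤ r ^ α * r - s ^ α * s := by
  rcases hs.eq_or_lt with h0 | h0
  · subst h0
    have : 0 < r ^ α * r := by positivity
    simp; nlinarith
  have hu : (s / r) ^ (1 + α) ≤ 1 + (1 + α) * (s / r - 1) := by
    have := rpow_one_add_le_one_add_mul_self (s := s / r - 1) (p := 1 + α)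
      (by have : 0 < s / r := by positivity
          linarith) (by linarith) (by linarith)
    simpa using this
  have e : s ^ α * s = r ^ α * r * (s / r) ^ (1 + α) := by
    rw [Real.div_rpow hs hr.le, Real.rpow_add h0, Real.rpow_add hr, Real.rpow_one, Real.rpow_one]
    field_simp
  rw [e]
  have hR : 0 < r ^ α := by positivity
  have h1 : r ^ α * r * (s / r) ^ (1 + α) ≤ r ^ α * r * (1 + (1 + α) * (s / r - 1)) := by gcongr
  have h2 : r ^ α * r * (1 + (1 + α) * (s / r - 1)) = r ^ α * r - (1 + α) * (r ^ α * (r - s)) := by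
    field_simp; ring
  have h3 : 0 ≤ r ^ α * (r - s) := mul_nonneg hR.le (by linarith)
  nlinarith

lemma Vp_lower_aux {ι : Type*} [Fintype ι] {p : ℝ} (hp : 1 < p) (hp2 : p < 2)
    (z w : EuclideanSpace ℝ ι) (h : ‖w‖ ≤ ‖z‖) :
    (1/2) * ‖z‖ ^ ((p - 2) / 2) * ‖z - w‖ ≤ ‖Vp p z - Vp p w‖ := by
  rcases (norm_nonneg z).eq_or_lt with h0 | hr
  · rw [← h0, Real.zero_rpow (by linarith)]; simp
  rcases (norm_nonneg w).eq_or_lt with h0 | hs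
  · have : w = 0 := norm_eq_zero.1 h0.symm
    subst this
    simp only [Vp, smul_zero, sub_zero, norm_smul]
    rw [Real.norm_of_nonneg (by positivity)]
    have : 0 ≤ ‖z‖ ^ ((p - 2) / 2) * ‖z‖ := by positivity
    linarith
  apply le_of_sq_le_sq _ (norm_nonneg _)
  have hl := scal_lower hr hs.le (α := (p - 2) / 2) (by linarith) (by linarith) h
  have hmono : ‖z‖ ^ ((p - 2) / 2) ≤ ‖w‖ ^ ((p - 2) / 2) :=
    Real.rpow_le_rpow_of_nonpos hs h (by linarith)
  have hR : 0 < ‖z‖ ^ ((p - 2) / 2) := by positivity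
  unfold Vp
  rw [mul_pow, @norm_sub_sq_real _ _ _ z w, norm_sub_sq_real, norm_smul, norm_smul, real_inner_smul_left,
    real_inner_smul_right, Real.norm_of_nonneg (by positivity), Real.norm_of_nonneg (by positivity)]
  have hc := real_inner_le_norm z w
  set R := ‖z‖ ^ ((p - 2) / 2)
  set S := ‖w‖ ^ ((p - 2) / 2)
  set r := ‖z‖
  set s := ‖w‖
  set i := inner ℝ z w
  have h1 : ((1/2) * R * (r - s)) ^ 2 ≤ (R * r - S * s) ^ 2 :=
    pow_le_pow_left₀ (mul_nonneg (by positivity) (by linarith)) hl 2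
  have h2 : (R * R) * (r * s - i) ≤ (R * S) * (r * s - i) :=
    mul_le_mul_of_nonneg_right (by gcongr) (by linarith)
  have h3 : 0 ≤ (R * R) * (r * s - i) := mul_nonneg (by positivity) (by linarith)
  nlinarith

lemma Vp_upper_aux {ι : Type*} [Fintype ι] {p : ℝ} (hp : 1 < p) (hp2 : p < 2)
    (z w : EuclideanSpace ℝ ι) (h : ‖w‖ ≤ ‖z‖) :
    ‖Vp p z - Vp p w‖ ≤ 2 * ‖z‖ ^ ((p - 2) / 2) * ‖z - w‖ := by
  rcases (norm_nonneg w).eq_or_lt with h0 | hs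
  · have : w = 0 := norm_eq_zero.1 h0.symm
    subst this
    simp only [Vp, smul_zero, sub_zero, norm_smul]
    rw [Real.norm_of_nonneg (by positivity)]
    have : 0 ≤ ‖z‖ ^ ((p - 2) / 2) * ‖z‖ := by positivity
    linarith
  have hr : 0 < ‖z‖ := hs.trans_le h
  have hmono : ‖z‖ ^ ((p - 2) / 2) ≤ ‖w‖ ^ ((p - 2) / 2) :=
    Real.rpow_le_rpow_of_nonpos hs h (by linarith)
  have e : Vp p z - Vp p w = (‖z‖ ^ ((p - 2) / 2)) • (z - w)
      - (‖w‖ ^ ((p - 2) / 2) - ‖z‖ ^ ((p - 2) / 2)) • w := by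
    unfold Vp; module
  have hm2 : ‖w‖ ^ ((p - 2) / 2) * ‖w‖ ≤ ‖z‖ ^ ((p - 2) / 2) * ‖z‖ := by
    have a1 := Vp_norm hp z
    have a2 := Vp_norm hp w
    simp only [Vp, norm_smul] at a1 a2
    rw [Real.norm_of_nonneg (by positivity)] at a1 a2
    rw [a1, a2]
    exact Real.rpow_le_rpow hs.le h (by linarith)
  rw [e]
  refine (norm_sub_le _ _).trans ?_
  rw [norm_smul, norm_smul, Real.norm_of_nonneg (by positivity),
    Real.norm_of_nonneg (by linarith)]
  have ht : ‖z‖ - ‖w‖ ≤ ‖z - w‖ := norm_sub_norm_le z w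
  have hR : 0 < ‖z‖ ^ ((p - 2) / 2) := by positivity
  nlinarith

/-- squared comparison function -/
noncomputable def GG (p A t : ℝ) : ℝ := (A + t) ^ (p - 2) * t ^ 2

lemma GG_eq {p A t : ℝ} (hA : 0 ≤ A) (ht : 0 ≤ t) :
    GG p A t = ((A + t) ^ ((p - 2) / 2) * t) ^ 2 := by
  unfold GG
  rw [mul_pow, ← Real.rpow_mul_natCast (by positivity)]
  congr 2
  push_cast; ring

lemma Vp_lower {ι : Type*} [Fintype ι] {p : ℝ} (hp : 1 < p) (hp2 : p < 2)
    (z a : EuclideanSpace ℝ ι) :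
    GG p ‖a‖ ‖z - a‖ ≤ 4 * ‖Vp p z - Vp p a‖ ^ 2 := by
  rw [GG_eq (norm_nonneg _) (norm_nonneg _)]
  suffices H : (‖a‖ + ‖z - a‖) ^ ((p - 2) / 2) * ‖z - a‖ ≤ 2 * ‖Vp p z - Vp p a‖ by
    calc _ ≤ (2 * ‖Vp p z - Vp p a‖) ^ 2 := by gcongr
      _ = _ := by ring
  have ht : ‖z‖ ≤ ‖a‖ + ‖z - a‖ := by
    have := norm_sub_norm_le z a
    linarith
  rcases le_total ‖a‖ ‖z‖ with h | h
  · have := Vp_lower_aux hp hp2 z a h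
    rcases (norm_nonneg z).eq_or_lt with h0 | h0
    · have hz : z = 0 := norm_eq_zero.1 h0.symm
      have ha : a = 0 := by rw [← h0] at h; exact norm_le_zero_iff.1 h
      simp [hz, ha]
    have h2 : (‖a‖ + ‖z - a‖) ^ ((p - 2) / 2) ≤ ‖z‖ ^ ((p - 2) / 2) :=
      Real.rpow_le_rpow_of_nonpos h0 ht (by linarith)
    have h3 := mul_le_mul_of_nonneg_right h2 (norm_nonneg (z - a))
    linarith
  · have := Vp_lower_aux hp hp2 a z h
    rw [norm_sub_rev, norm_sub_rev (Vp p a)] at this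
    rcases (norm_nonneg a).eq_or_lt with h0 | h0
    · have hz : a = 0 := norm_eq_zero.1 h0.symm
      have ha : z = 0 := by rw [← h0] at h; exact norm_le_zero_iff.1 h
      simp [hz, ha]
    have h2 : (‖a‖ + ‖z - a‖) ^ ((p - 2) / 2) ≤ ‖a‖ ^ ((p - 2) / 2) :=
      Real.rpow_le_rpow_of_nonpos h0 (by linarith [norm_nonneg (z - a)]) (by linarith)
    have h3 := mul_le_mul_of_nonneg_right h2 (norm_nonneg (z - a))
    linarith

lemma rpow_three {p r x : ℝ} (hp : 1 < p) (hp2 : p < 2) (hr : 0 ≤ r) (hx : 0 < x) (h : x ≤ 3 * r) :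
    r ^ ((p - 2) / 2) ≤ 3 * x ^ ((p - 2) / 2) := by
  have h1 : (3 * r) ^ ((p - 2) / 2) ≤ x ^ ((p - 2) / 2) :=
    Real.rpow_le_rpow_of_nonpos hx h (by linarith)
  rw [Real.mul_rpow (by norm_num) hr] at h1
  have h2 : (3:ℝ) ^ (-1 : ℝ) ≤ 3 ^ ((p - 2) / 2) :=
    Real.rpow_le_rpow_of_exponent_le (by norm_num) (by linarith)
  rw [Real.rpow_neg_one] at h2
  have : 0 ≤ r ^ ((p - 2) / 2) := by positivity
  nlinarith

lemma Vp_upper {ι : Type*} [Fintype ι] {p : ℝ} (hp : 1 < p) (hp2 : p < 2)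
    (z a : EuclideanSpace ℝ ι) :
    ‖Vp p z - Vp p a‖ ^ 2 ≤ 36 * GG p ‖a‖ ‖z - a‖ := by
  rw [GG_eq (norm_nonneg _) (norm_nonneg _)]
  suffices H : ‖Vp p z - Vp p a‖ ≤ 6 * ((‖a‖ + ‖z - a‖) ^ ((p - 2) / 2) * ‖z - a‖) by
    calc _ ≤ (6 * ((‖a‖ + ‖z - a‖) ^ ((p - 2) / 2) * ‖z - a‖)) ^ 2 := by gcongr
      _ = _ := by ring
  rcases eq_or_ne z a with rfl | hne
  · simp
  have hpos : 0 < ‖z - a‖ := norm_pos_iff.2 (sub_ne_zero.2 hne)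
  have hx : 0 < ‖a‖ + ‖z - a‖ := by positivity
  have ht := norm_sub_le z a
  rcases le_total ‖a‖ ‖z‖ with h | h
  · have := Vp_upper_aux hp hp2 z a h
    have h3 := rpow_three hp hp2 (norm_nonneg z) hx (by linarith)
    have h3 := mul_le_mul_of_nonneg_right h3 hpos.le
    linarith
  · have := Vp_upper_aux hp hp2 a z h
    rw [norm_sub_rev, norm_sub_rev a] at this
    have h3 := rpow_three hp hp2 (norm_nonneg a) hx (by linarith)
    have h3 := mul_le_mul_of_nonneg_right h3 hpos.le
    linarith

lemma GG_lin {p A m t : ℝ} (hp : 1 < p) (hp2 : p < 2) (hA : 0 ≤ A) (hm : 0 < m) (ht : 0 ≤ t) :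
    (t - m) * ((A + m) ^ (p - 2) * m) ≤ GG p A t := by
  have hK : 0 ≤ (A + m) ^ (p - 2) * m := by positivity
  have hG : 0 ≤ GG p A t := by unfold GG; positivity
  rcases le_total t m with h | h
  · nlinarith
  have htp : 0 < t := hm.trans_le h
  have key : (A + m) ^ (p - 2) * m ≤ (A + t) ^ (p - 2) * t := by
    have e : ∀ x, 0 < x → (A + x) ^ (p - 2) * x = (A + x) ^ (p - 1) - A * (A + x) ^ (p - 2) := by
      intro x hx
      have : (A + x) ^ (p - 1) = (A + x) ^ (p - 2) * (A + x) := by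
        nth_rewrite 3 [← Real.rpow_one (A + x)]
        rw [← Real.rpow_add (by positivity)]; congr 1; ring
      rw [this]; ring
    rw [e m hm, e t htp]
    have h1 : (A + m) ^ (p - 1) ≤ (A + t) ^ (p - 1) :=
      Real.rpow_le_rpow (by positivity) (by linarith) (by linarith)
    have h2 : (A + t) ^ (p - 2) ≤ (A + m) ^ (p - 2) :=
      Real.rpow_le_rpow_of_nonpos (by positivity) (by linarith) (by linarith)
    have h3 := mul_le_mul_of_nonneg_left h2 hA
    linarith
  calc _ ≤ t * ((A + m) ^ (p - 2) * m) := by gcongr; linarith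
    _ ≤ t * ((A + t) ^ (p - 2) * t) := by gcongr
    _ = _ := by unfold GG; ring

lemma GG_half {p A m : ℝ} (hp2 : p < 2) (hA : 0 ≤ A) (hm : 0 < m) :
    GG p A m ≤ 4 * GG p A (m / 2) := by
  unfold GG
  have h2 : (A + m) ^ (p - 2) ≤ (A + m / 2) ^ (p - 2) :=
    Real.rpow_le_rpow_of_nonpos (by positivity) (by linarith) (by linarith)
  have := mul_le_mul_of_nonneg_right h2 (sq_nonneg m)
  linarith

lemma mean_min {Ω E : Type*} [MeasurableSpace Ω] [NormedAddCommGroup E] [InnerProductSpace ℝ E]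
    [CompleteSpace E] (μ : Measure Ω) [IsProbabilityMeasure μ] (f : Ω → E) (hf : MemLp f 2 μ) (v : E) :
    ∫ x, ‖f x - ∫ y, f y ∂μ‖ ^ 2 ∂μ ≤ ∫ x, ‖f x - v‖ ^ 2 ∂μ := by
  set b := ∫ y, f y ∂μ with hb
  have hi : Integrable f μ := hf.integrable (by norm_num)
  have h1 : Integrable (fun x => ‖f x - b‖ ^ 2) μ := (hf.sub (memLp_const b)).integrable_norm_pow (by norm_num)
  have hfb : Integrable (fun x => f x - b) μ := hi.sub (integrable_const b)
  have h2 : Integrable (fun x => 2 * inner ℝ (b - v) (f x - b)) μ := (hfb.const_inner (b - v)).const_mul 2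
  have e : ∀ x, ‖f x - v‖ ^ 2 = ‖f x - b‖ ^ 2 + 2 * inner ℝ (b - v) (f x - b) + ‖b - v‖ ^ 2 := by
    intro x
    have : f x - v = (f x - b) + (b - v) := by abel
    rw [this, norm_add_sq_real, real_inner_comm]
  simp_rw [e]
  have h12 : Integrable (fun x => ‖f x - b‖ ^ 2 + 2 * inner ℝ (b - v) (f x - b)) μ := h1.add h2
  rw [integral_add h12 (integrable_const _), integral_add h1 h2, integral_const_mul,
    integral_inner hfb, integral_sub hi (integrable_const b)]
  simp [← hb]

lemma prob_main {Ω ι : Type*} [MeasurableSpace Ω] [Fintype ι] (μ : Measure Ω) [IsProbabilityMeasure μ]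
    {p : ℝ} (hp : 1 < p) (hp2 : p < 2) (g : Ω → EuclideanSpace ℝ ι) (hg : Measurable g)
    (hi : Integrable (fun x => ‖g x‖ ^ p) μ) :
    (∫ x, ‖Vp p (g x) - ∫ y, Vp p (g y) ∂μ‖ ^ 2 ∂μ ≤ ∫ x, ‖Vp p (g x) - Vp p (∫ y, g y ∂μ)‖ ^ 2 ∂μ) ∧
    ∫ x, ‖Vp p (g x) - Vp p (∫ y, g y ∂μ)‖ ^ 2 ∂μ ≤
      10000 * ∫ x, ‖Vp p (g x) - ∫ y, Vp p (g y) ∂μ‖ ^ 2 ∂μ := by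
  have hVm : Measurable (fun x => Vp p (g x)) := by
    unfold Vp; exact (hg.norm.pow_const _).smul hg
  have hV : MemLp (fun x => Vp p (g x)) 2 μ := by
    rw [memLp_two_iff_integrable_sq_norm hVm.aestronglyMeasurable]
    refine hi.congr (Filter.Eventually.of_forall fun x => ?_)
    simp only [Vp_norm hp]
    rw [← Real.rpow_mul_natCast (by positivity)]
    congr 1; push_cast; ring
  have hgi : Integrable g μ := by
    refine Integrable.mono' ((integrable_const (1:ℝ)).add hi) hg.aestronglyMeasurable
      (Filter.Eventually.of_forall fun x => ?_)
    simp only [Pi.add_apply]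
    rcases le_total ‖g x‖ 1 with h | h
    · have : 0 ≤ ‖g x‖ ^ p := by positivity
      linarith
    · have := Real.rpow_le_rpow_of_exponent_le h hp.le
      rw [Real.rpow_one] at this
      linarith
  refine ⟨mean_min μ _ hV _, ?_⟩
  obtain ⟨a, ha⟩ := Vp_surj hp (∫ y, Vp p (g y) ∂μ)
  rw [← ha]
  set b := ∫ y, g y ∂μ with hb
  have hIa : Integrable (fun x => ‖Vp p (g x) - Vp p a‖ ^ 2) μ :=
    (hV.sub (memLp_const _)).integrable_norm_pow (by norm_num)
  have hIb : Integrable (fun x => ‖Vp p (g x) - Vp p b‖ ^ 2) μ :=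
    (hV.sub (memLp_const _)).integrable_norm_pow (by norm_num)
  set I := ∫ x, ‖Vp p (g x) - Vp p a‖ ^ 2 ∂μ with hI
  have hI0 : 0 ≤ I := integral_nonneg fun x => by positivity
  have key : ‖Vp p b - Vp p a‖ ^ 2 ≤ 576 * I := by
    rcases eq_or_ne b a with h | hne
    · rw [h]; simpa using hI0
    have hm : 0 < ‖b - a‖ := norm_pos_iff.2 (sub_ne_zero.2 hne)
    have hga : Integrable (fun x => g x - a) μ := hgi.sub (integrable_const a)
    have hmle : ‖b - a‖ ≤ ∫ x, ‖g x - a‖ ∂μ := by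
      have : b - a = ∫ x, (g x - a) ∂μ := by
        rw [integral_sub hgi (integrable_const a)]; simp [hb]
      rw [this]; exact norm_integral_le_integral_norm _
    set m := ‖b - a‖ with hmdef
    set K := (‖a‖ + m / 2) ^ (p - 2) * (m / 2) with hK
    have hK0 : 0 ≤ K := by positivity
    have hpt : ∀ x, (‖g x - a‖ - m / 2) * K ≤ 4 * ‖Vp p (g x) - Vp p a‖ ^ 2 := fun x =>
      (GG_lin hp hp2 (norm_nonneg a) (by positivity) (norm_nonneg _)).trans (Vp_lower hp hp2 _ _)
    have hint : ∫ x, (‖g x - a‖ - m / 2) * K ∂μ ≤ ∫ x, 4 * ‖Vp p (g x) - Vp p a‖ ^ 2 ∂μ :=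
      integral_mono ((hga.norm.sub (integrable_const _)).mul_const K) (hIa.const_mul 4) hpt
    rw [integral_mul_const, integral_sub hga.norm (integrable_const _), integral_const_mul] at hint
    simp only [integral_const, probReal_univ, one_smul] at hint
    have h1 : (m / 2) * K ≤ 4 * I := by
      refine le_trans ?_ hint
      gcongr; linarith
    have h2 : (m / 2) * K = GG p ‖a‖ (m / 2) := by unfold GG; rw [hK]; ring
    have h3 := GG_half hp2 (norm_nonneg a) hm
    have h4 := Vp_upper hp hp2 b a
    linarith
  have hfin : ∫ x, ‖Vp p (g x) - Vp p b‖ ^ 2 ∂μ ≤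
      ∫ x, (2 * ‖Vp p (g x) - Vp p a‖ ^ 2 + 2 * ‖Vp p b - Vp p a‖ ^ 2) ∂μ := by
    refine integral_mono hIb ((hIa.const_mul 2).add (integrable_const _)) fun x => ?_
    have h := norm_sub_le_norm_sub_add_norm_sub (Vp p (g x)) (Vp p a) (Vp p b)
    rw [norm_sub_rev (Vp p a)] at h
    have h' := pow_le_pow_left₀ (norm_nonneg _) h 2
    simp only
    nlinarith [sq_nonneg (‖Vp p (g x) - Vp p a‖ - ‖Vp p b - Vp p a‖)]
  rw [integral_add (hIa.const_mul 2) (integrable_const _), integral_const_mul] at hfin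
  simp only [integral_const, probReal_univ, one_smul] at hfin
  linarith

/-- For `1 < p < 2` there is `c = c(n,N,p) ≥ 1` such that for every ball `B ⊂ ℝⁿ`
and every measurable `g` with `|g|^p` integrable on `B`,
`𝔉(g;B) ≈ (⨍_B |V_p(g) − V_p((g)_B)|² dx)^{1/2}`. -/
theorem excess_mean_equiv (n N : ℕ) (hn : 1 ≤ n) (hN : 1 ≤ N)
    (p : ℝ) (hp : 1 < p) (hp2 : p < 2) :
    ∃ c : ℝ, 1 ≤ c ∧
      ∀ (x₀ : EuclideanSpace ℝ (Fin n)) (ρ : ℝ), 0 < ρ →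
        ∀ g : EuclideanSpace ℝ (Fin n) → EuclideanSpace ℝ (Fin N × Fin n),
          Measurable g →
          IntegrableOn (fun x => ‖g x‖ ^ p) (Metric.ball x₀ ρ) volume →
          c⁻¹ * excess p g (Metric.ball x₀ ρ) ≤
              (⨍ x in Metric.ball x₀ ρ,
                ‖Vp p (g x) - Vp p (⨍ y in Metric.ball x₀ ρ, g y ∂volume)‖ ^ 2
                  ∂volume) ^ (1 / 2 : ℝ) ∧
            (⨍ x in Metric.ball x₀ ρ,
                ‖Vp p (g x) - Vp p (⨍ y in Metric.ball x₀ ρ, g y ∂volume)‖ ^ 2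
                  ∂volume) ^ (1 / 2 : ℝ) ≤
              c * excess p g (Metric.ball x₀ ρ) := by
  refine ⟨100, by norm_num, fun x₀ ρ hρ g hg hi => ?_⟩
  have hne : volume (Metric.ball x₀ ρ) ≠ 0 := (Metric.measure_ball_pos volume x₀ hρ).ne'
  have hfin : volume (Metric.ball x₀ ρ) ≠ ⊤ := measure_ball_lt_top.ne
  haveI : IsProbabilityMeasure (((volume.restrict (Metric.ball x₀ ρ)) Set.univ)⁻¹ •
      volume.restrict (Metric.ball x₀ ρ)) := by
    constructor
    simp [ENNReal.inv_mul_cancel hne hfin]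
  have hi' := Integrable.smul_measure hi
    (c := ((volume.restrict (Metric.ball x₀ ρ)) Set.univ)⁻¹) (by simpa using hne)
  obtain ⟨h1, h2⟩ := prob_main _ hp hp2 g hg hi'
  unfold excess
  simp only [average]
  set μ := (((volume.restrict (Metric.ball x₀ ρ)) Set.univ)⁻¹ •
      volume.restrict (Metric.ball x₀ ρ))
  have hE0 : 0 ≤ ∫ x, ‖Vp p (g x) - ∫ y, Vp p (g y) ∂μ‖ ^ 2 ∂μ :=
    integral_nonneg fun x => by positivity
  have hD0 : 0 ≤ ∫ x, ‖Vp p (g x) - Vp p (∫ y, g y ∂μ)‖ ^ 2 ∂μ :=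
    integral_nonneg fun x => by positivity
  simp only [← Real.sqrt_eq_rpow]
  constructor
  · have := Real.sqrt_le_sqrt h1
    have h0 := Real.sqrt_nonneg (∫ x, ‖Vp p (g x) - ∫ y, Vp p (g y) ∂μ‖ ^ 2 ∂μ)
    norm_num
    linarith
  · have := Real.sqrt_le_sqrt h2
    rw [Real.sqrt_mul (by norm_num)] at this
    have e : √(10000:ℝ) = 100 := by
      rw [show (10000:ℝ) = 100 ^ 2 by norm_num]; exact Real.sqrt_sq (by norm_num)
    rwa [e] at this
end

section
/- Let n ≥ 2, N ≥ 1, p ∈ (1,2), λ > 0, and let F : ℝ^{N×n} → ℝ be of class C¹ on ℝ^{N×n} and of class C² on ℝ^{N×n} ∖ {0}. Assume F is strictly degenerate quasiconvex, i.e. for every ball B ⊂ ℝⁿ, every z ∈ ℝ^{N×n} and every φ ∈ C_c^∞(B, ℝ^N) it holds that ∫_B [F(z + Dφ(x)) − F(z)] dx ≥ λ ∫_B (|z|² + |Dφ(x)|²)^{(p−2)/2} |Dφ(x)|² dx. Then for every z ∈ ℝ^{N×n} ∖ {0}, every ξ ∈ ℝ^N and every ζ ∈ ℝⁿ one has ∂²F(z)⟨ξ⊗ζ,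 ξ⊗ζ⟩ ≥ 2λ |z|^{p−2} |ξ|² |ζ|², where ξ⊗ζ ∈ ℝ^{N×n} is the rank-one matrix with entries ξᵢζⱼ and ∂²F(z) is the second derivative of F at z, viewed as a bilinear form on ℝ^{N×n}. -/
open MeasureTheory

/-- The gradient of a map `φ : ℝⁿ → ℝ^N`, identified with an element of the
Euclidean space `ℝ^{N×n}` via `(Dφ(x))_{ij} = ∂_j φ_i(x)`. -/
noncomputable def gradMatrix {n N : ℕ}
    (φ : EuclideanSpace ℝ (Fin n) → EuclideanSpace ℝ (Fin N))
    (x : EuclideanSpace ℝ (Fin n)) : EuclideanSpace ℝ (Fin N × Fin n) :=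
  (EuclideanSpace.equiv (Fin N × Fin n) ℝ).symm
    fun q => fderiv ℝ φ x (EuclideanSpace.single q.2 (1 : ℝ)) q.1

/-- The rank-one matrix `ξ ⊗ ζ ∈ ℝ^{N×n}` with entries `ξᵢ ζⱼ`. -/
noncomputable def rankOne {n N : ℕ} (ξ : EuclideanSpace ℝ (Fin N))
    (ζ : EuclideanSpace ℝ (Fin n)) : EuclideanSpace ℝ (Fin N × Fin n) :=
  (EuclideanSpace.equiv (Fin N × Fin n) ℝ).symm fun q => ξ q.1 * ζ q.2

lemma aux_taylor {E : Type*} [NormedAddCommGroup E] [NormedSpace ℝ E] (F : E → ℝ) (z : E)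
    (hF : Differentiable ℝ F) (hF' : DifferentiableAt ℝ (fderiv ℝ F) z)
    (hs : IsSymmSndFDerivAt ℝ F z) (ε : ℝ) (hε : 0 < ε) :
    ∃ δ > 0, ∀ h : E, ‖h‖ < δ →
      F (z + h) - F z ≤ fderiv ℝ F z h + 1 / 2 * fderiv ℝ (fderiv ℝ F) z h h + ε * ‖h‖ ^ 2 := by
  have h1 := hF'.hasFDerivAt
  rw [hasFDerivAt_iff_isLittleO_nhds_zero] at h1
  have h2 := h1.def hε
  rw [Metric.eventually_nhds_iff] at h2
  obtain ⟨δ, hδ, h2⟩ := h2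
  refine ⟨δ, hδ, fun h hh => ?_⟩
  set B := fderiv ℝ (fderiv ℝ F) z with hB
  set g : E → ℝ := fun h => F (z + h) - fderiv ℝ F z h - 1 / 2 * B h h with hg
  have hd : ∀ x : E, HasFDerivAt g (fderiv ℝ F (z + x) - fderiv ℝ F z - B x) x := by
    intro x
    have e1 : HasFDerivAt (fun h => F (z + h)) (fderiv ℝ F (z + x)) x :=
      (hasFDerivAt_comp_add_left z).2 (hF (z + x)).hasFDerivAt
    have e2 : HasFDerivAt (fun h => fderiv ℝ F z h) (fderiv ℝ F z) x :=
      (fderiv ℝ F z).hasFDerivAt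
    have e3 : HasFDerivAt (fun h => B h h) _ x :=
      (B.hasFDerivAt (x := x)).clm_apply (hasFDerivAt_id x)
    have e4 := (e1.sub e2).sub (e3.const_mul (1 / 2))
    refine e4.congr_fderiv ?_
    ext k
    have := hs x k
    simp at this ⊢
    rw [← hB] at this
    linarith
  have hball : Convex ℝ (Metric.closedBall (0 : E) ‖h‖) := convex_closedBall _ _
  have key := hball.norm_image_sub_le_of_norm_hasFDerivWithin_le (f := g) (C := ε * ‖h‖)
    (fun x _ => (hd x).hasFDerivWithinAt) (fun x hx => by
      have hx' : ‖x‖ ≤ ‖h‖ := by simpa using hx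
      have := h2 (y := x) (by simpa using lt_of_le_of_lt hx' hh)
      exact this.trans (by gcongr)) (x := 0) (y := h) (by simp) (by simp)
  have k2 := (le_abs_self _).trans key
  simp [hg] at k2
  nlinarith

lemma aux_integrable {n : ℕ} (f : EuclideanSpace ℝ (Fin n) → ℝ)
    (hf : ContDiff ℝ (⊤ : ℕ∞) f) (hc : HasCompactSupport f)
    (G : EuclideanSpace ℝ (Fin n) → ℝ) (hG : Continuous G) (hG0 : G 0 = 0) :
    Integrable (fun x => G (gradient f x)) volume := by
  have hcont : Continuous (gradient f) :=
    (InnerProductSpace.toDual ℝ _).symm.continuous.comp (hf.continuous_fderiv (by simp))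
  have hcs : HasCompactSupport (gradient f) :=
    (hc.fderiv (𝕜 := ℝ)).comp_left (g := (InnerProductSpace.toDual ℝ _).symm) (by simp)
  exact (hG.comp hcont).integrable_of_hasCompactSupport (hcs.comp_left hG0)

lemma aux_lin {n : ℕ} (f : EuclideanSpace ℝ (Fin n) → ℝ)
    (hf : ContDiff ℝ (⊤ : ℕ∞) f) (hc : HasCompactSupport f)
    (l : EuclideanSpace ℝ (Fin n) →L[ℝ] ℝ) :
    ∫ x, l (gradient f x) = 0 := by
  have e : ∀ x, l (gradient f x) = fderiv ℝ f x ((InnerProductSpace.toDual ℝ _).symm l) := by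
    intro x
    rw [← inner_gradient_left, real_inner_comm, InnerProductSpace.toDual_symm_apply]
  have hi := aux_integrable f hf hc l l.continuous (by simp)
  simp_rw [e] at hi ⊢
  have := integral_mul_fderiv_eq_neg_fderiv_mul_of_integrable (𝕜 := ℝ) (μ := volume)
    (f := fun _ : EuclideanSpace ℝ (Fin n) => (1 : ℝ)) (g := f)
    (v := (InnerProductSpace.toDual ℝ _).symm l) (by simp) (by simpa using hi)
    (by simpa using hf.continuous.integrable_of_hasCompactSupport hc)
    (by simp) (fun x _ => (hf.differentiable (by simp)) x)
  simpa using this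

lemma aux_A {n : ℕ} (G : EuclideanSpace ℝ (Fin n) → ℝ) (hG : Continuous G) (hG0 : G 0 = 0)
    (l : EuclideanSpace ℝ (Fin n) →L[ℝ] ℝ)
    (B : EuclideanSpace ℝ (Fin n) →L[ℝ] EuclideanSpace ℝ (Fin n) →L[ℝ] ℝ)
    (hle : ∀ ε > 0, ∃ δ > 0, ∀ v, ‖v‖ < δ → G v ≤ l v + B v v + ε * ‖v‖ ^ 2)
    (hpos : ∀ f : EuclideanSpace ℝ (Fin n) → ℝ, ContDiff ℝ (⊤ : ℕ∞) f → HasCompactSupport f →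
      0 ≤ ∫ x, G (gradient f x))
    (f : EuclideanSpace ℝ (Fin n) → ℝ) (hf : ContDiff ℝ (⊤ : ℕ∞) f) (hc : HasCompactSupport f) :
    0 ≤ ∫ x, B (gradient f x) (gradient f x) := by
  have hB : Continuous fun v => B v v := by fun_prop
  have hBi := aux_integrable f hf hc (fun v => B v v) hB (by simp)
  have hNi := aux_integrable f hf hc (fun v => ‖v‖ ^ 2) (by fun_prop) (by simp)
  have hli := aux_integrable f hf hc l l.continuous (by simp)
  have hcont : Continuous (gradient f) :=
    (InnerProductSpace.toDual ℝ _).symm.continuous.comp (hf.continuous_fderiv (by simp))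
  have hcs : HasCompactSupport (gradient f) :=
    (hc.fderiv (𝕜 := ℝ)).comp_left (g := (InnerProductSpace.toDual ℝ _).symm) (by simp)
  obtain ⟨C, hC⟩ := hcs.exists_bound_of_continuous hcont
  have hC0 : 0 ≤ C := (norm_nonneg _).trans (hC 0)
  have main : ∀ ε > 0, 0 ≤ (∫ x, B (gradient f x) (gradient f x))
      + ε * ∫ x, ‖gradient f x‖ ^ 2 := by
    intro ε hε
    obtain ⟨δ, hδ, hle⟩ := hle ε hε
    set t := δ / (2 * (C + 1)) with ht
    have ht0 : 0 < t := by positivity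
    have htC : t * C < δ := by
      rw [ht, div_mul_eq_mul_div, div_lt_iff₀ (by positivity)]; nlinarith
    have hgr : ∀ x, gradient (fun x => t * f x) x = t • gradient f x := by
      intro x
      simp only [gradient]
      rw [fderiv_const_mul ((hf.differentiable (by simp)) x)]
      simp
    have hft : ContDiff ℝ (⊤ : ℕ∞) (fun x => t * f x) := contDiff_const.mul hf
    have hct : HasCompactSupport (fun x => t * f x) := hc.mul_left
    have h1 := hpos _ hft hct
    have h2 := aux_integrable _ hft hct G hG hG0
    simp_rw [hgr] at h1 h2
    have h3 : ∫ x, G (t • gradient f x) ≤ ∫ x, (t * l (gradient f x) +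
        (t ^ 2 * B (gradient f x) (gradient f x) + t ^ 2 * ε * ‖gradient f x‖ ^ 2)) := by
      refine integral_mono h2 ((hli.const_mul t).add
        ((hBi.const_mul _).add (hNi.const_mul _))) (fun x => ?_)
      have := hle (t • gradient f x) (by
        rw [norm_smul, Real.norm_of_nonneg ht0.le]
        exact lt_of_le_of_lt (by gcongr; exact hC x) htC)
      simp only [map_smul, _root_.smul_apply, smul_eq_mul, norm_smul, mul_pow,
        Real.norm_eq_abs, sq_abs] at this
      simp only
      linarith
    have h2' : Integrable fun x => t ^ 2 * B (gradient f x) (gradient f x) := hBi.const_mul _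
    have h2'' : Integrable fun x => t ^ 2 * ε * ‖gradient f x‖ ^ 2 := hNi.const_mul _
    have h2l : Integrable fun x => t * l (gradient f x) := hli.const_mul _
    have h2a : Integrable fun x => t ^ 2 * B (gradient f x) (gradient f x)
        + t ^ 2 * ε * ‖gradient f x‖ ^ 2 := h2'.add h2''
    rw [integral_add h2l h2a, integral_add h2' h2'', integral_const_mul,
      integral_const_mul, integral_const_mul, aux_lin f hf hc l] at h3
    have h4 : 0 ≤ t ^ 2 * ((∫ x, B (gradient f x) (gradient f x))
      + ε * ∫ x, ‖gradient f x‖ ^ 2) := by linarith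
    exact nonneg_of_mul_nonneg_right h4 (by positivity)
  set I := ∫ x, B (gradient f x) (gradient f x)
  have hJ : 0 ≤ ∫ x, ‖gradient f x‖ ^ 2 := integral_nonneg fun x => by positivity
  set J := ∫ x, ‖gradient f x‖ ^ 2
  by_contra hneg
  push Not at hneg
  have := main (-I / (2 * (J + 1))) (div_pos (by linarith) (by positivity))
  have h5 : -I / (2 * (J + 1)) * J < -I := by
    rw [div_mul_eq_mul_div, div_lt_iff₀ (by positivity)]; nlinarith
  linarith

lemma aux_trig {n : ℕ} (ρ : EuclideanSpace ℝ (Fin n) → ℝ) (hρ : ContDiff ℝ (⊤ : ℕ∞) ρ)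
    (hρc : HasCompactSupport ρ) (w : EuclideanSpace ℝ (Fin n)) :
    ∃ f₁ f₂ : EuclideanSpace ℝ (Fin n) → ℝ, ContDiff ℝ (⊤ : ℕ∞) f₁ ∧ ContDiff ℝ (⊤ : ℕ∞) f₂ ∧
      HasCompactSupport f₁ ∧ HasCompactSupport f₂ ∧
      (∀ x, gradient f₁ x = Real.cos (inner ℝ w x) • gradient ρ x
        - (Real.sin (inner ℝ w x) * ρ x) • w) ∧
      (∀ x, gradient f₂ x = Real.sin (inner ℝ w x) • gradient ρ x
        + (Real.cos (inner ℝ w x) * ρ x) • w) := by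
  have hin : ContDiff ℝ (⊤ : ℕ∞) (fun x : EuclideanSpace ℝ (Fin n) => inner ℝ w x) :=
    contDiff_const.inner ℝ contDiff_id
  have hdi : ∀ x, HasFDerivAt (fun x : EuclideanSpace ℝ (Fin n) => inner ℝ w x)
      (innerSL ℝ w) x := fun x => (innerSL ℝ w).hasFDerivAt
  have hdρ : ∀ x, HasFDerivAt ρ (fderiv ℝ ρ x) x :=
    fun x => (hρ.differentiable (by simp) x).hasFDerivAt
  refine ⟨fun x => ρ x * Real.cos (inner ℝ w x), fun x => ρ x * Real.sin (inner ℝ w x),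
    hρ.mul (Real.contDiff_cos.comp hin), hρ.mul (Real.contDiff_sin.comp hin),
    hρc.mul_right, hρc.mul_right, fun x => ?_, fun x => ?_⟩
  · refine ext_inner_right ℝ fun v => ?_
    rw [inner_gradient_left, ((hdρ x).fun_mul (hdi x).cos).fderiv]
    simp [inner_sub_left, inner_smul_left, inner_gradient_left]
    ring
  · refine ext_inner_right ℝ fun v => ?_
    rw [inner_gradient_left, ((hdρ x).fun_mul (hdi x).sin).fderiv]
    simp [inner_add_left, inner_smul_left, inner_gradient_left]
    ring

lemma aux_end (b D J : ℝ) (hJ : 0 < J) (h : ∀ k : ℕ, 0 ≤ D + (k : ℝ) ^ 2 * b * J) : 0 ≤ b := by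
  by_contra hneg
  push Not at hneg
  have hn : b * J < 0 := mul_neg_of_neg_of_pos hneg hJ
  obtain ⟨k, hk⟩ := exists_nat_gt (|D| / (-(b * J)) + 1)
  have h0 : 0 ≤ |D| / (-(b * J)) := div_nonneg (abs_nonneg _) (by linarith)
  have hk2 : |D| / (-(b * J)) < (k : ℝ) ^ 2 := by nlinarith
  rw [div_lt_iff₀ (by linarith)] at hk2
  have h1 := h k
  have h2 := le_abs_self D
  linarith

lemma aux_bump (n : ℕ) : ∃ ρ : EuclideanSpace ℝ (Fin n) → ℝ, ContDiff ℝ (⊤ : ℕ∞) ρ ∧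
    HasCompactSupport ρ ∧ (Integrable fun x => ρ x ^ 2) ∧ 0 < ∫ x, ρ x ^ 2 := by
  let b : ContDiffBump (0 : EuclideanSpace ℝ (Fin n)) := ⟨1, 2, by norm_num, by norm_num⟩
  refine ⟨b, b.contDiff, b.hasCompactSupport, ?_, ?_⟩
  · have hcc : Continuous fun x => b x ^ 2 := b.continuous.pow 2
    exact hcc.integrable_of_hasCompactSupport
      (b.hasCompactSupport.comp_left (g := fun y : ℝ => y ^ 2) (by simp))
  have hcc : Continuous fun x => b x ^ 2 := b.continuous.pow 2
  have h0 : b 0 = 1 := b.one_of_mem_closedBall (by simp [b])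
  refine hcc.integral_pos_of_hasCompactSupport_nonneg_nonzero
    (b.hasCompactSupport.comp_left (g := fun y : ℝ => y ^ 2) (by simp))
    (fun x => sq_nonneg _) (x := 0) ?_
  simp [h0]

lemma aux_alg {n : ℕ}
    (B : EuclideanSpace ℝ (Fin n) →L[ℝ] EuclideanSpace ℝ (Fin n) →L[ℝ] ℝ)
    (g w : EuclideanSpace ℝ (Fin n)) (c s r : ℝ) (h : c ^ 2 + s ^ 2 = 1) :
    B (c • g - (s * r) • w) (c • g - (s * r) • w) + B (s • g + (c * r) • w) (s • g + (c * r) • w)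
      = B g g + B w w * r ^ 2 := by
  simp only [map_add, map_sub, map_smul, _root_.add_apply,
      _root_.sub_apply, _root_.smul_apply, smul_eq_mul]
  linear_combination (B g g + B w w * r ^ 2) * h

lemma aux_B {n : ℕ}
    (B : EuclideanSpace ℝ (Fin n) →L[ℝ] EuclideanSpace ℝ (Fin n) →L[ℝ] ℝ)
    (hpos : ∀ f : EuclideanSpace ℝ (Fin n) → ℝ, ContDiff ℝ (⊤ : ℕ∞) f → HasCompactSupport f →
      0 ≤ ∫ x, B (gradient f x) (gradient f x)) (ζ : EuclideanSpace ℝ (Fin n)) :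
    0 ≤ B ζ ζ := by
  obtain ⟨ρ, hρ, hρc, hJi, hJ⟩ := aux_bump n
  have hB : Continuous fun v => B v v := by fun_prop
  have hB0 : B 0 0 = 0 := by simp
  have hBi : Integrable fun x => B (gradient ρ x) (gradient ρ x) :=
    aux_integrable ρ hρ hρc (fun v => B v v) hB hB0
  have key : ∀ w : EuclideanSpace ℝ (Fin n), 0 ≤ (∫ x, B (gradient ρ x) (gradient ρ x))
      + B w w * ∫ x, ρ x ^ 2 := by
    intro w
    obtain ⟨f₁, f₂, c1, c2, s1, s2, g1, g2⟩ := aux_trig ρ hρ hρc w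
    have i1 : Integrable fun x => B (gradient f₁ x) (gradient f₁ x) :=
      aux_integrable f₁ c1 s1 (fun v => B v v) hB hB0
    have i2 : Integrable fun x => B (gradient f₂ x) (gradient f₂ x) :=
      aux_integrable f₂ c2 s2 (fun v => B v v) hB hB0
    have h0 := add_nonneg (hpos f₁ c1 s1) (hpos f₂ c2 s2)
    have hJw : Integrable fun x => B w w * ρ x ^ 2 := hJi.const_mul _
    have e1 : ∀ x, B (gradient f₁ x) (gradient f₁ x) + B (gradient f₂ x) (gradient f₂ x)
        = B (gradient ρ x) (gradient ρ x) + B w w * ρ x ^ 2 := by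
      intro x
      rw [g1, g2]
      exact aux_alg B _ w _ _ _ (Real.cos_sq_add_sin_sq _)
    have e2 := integral_add i1 i2
    have e3 := integral_add hBi hJw
    rw [integral_const_mul] at e3
    rw [← e3, ← integral_congr_ae (Filter.Eventually.of_forall e1), e2]
    exact h0
  refine aux_end (B ζ ζ) (∫ x, B (gradient ρ x) (gradient ρ x)) _ hJ fun k => ?_
  have h := key ((k : ℝ) • ζ)
  have e : B ((k : ℝ) • ζ) ((k : ℝ) • ζ) = (k : ℝ) ^ 2 * B ζ ζ := by
    simp only [map_smul, _root_.smul_apply, smul_eq_mul]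
    ring
  rwa [e] at h

lemma aux_norm_rankOne {n N : ℕ} (ξ : EuclideanSpace ℝ (Fin N))
    (ζ : EuclideanSpace ℝ (Fin n)) : ‖rankOne ξ ζ‖ ^ 2 = ‖ξ‖ ^ 2 * ‖ζ‖ ^ 2 := by
  simp only [EuclideanSpace.norm_sq_eq, rankOne]
  rw [Finset.sum_mul_sum, Fintype.sum_prod_type]
  simp [mul_pow]

lemma aux_exists_T {n N : ℕ} (ξ : EuclideanSpace ℝ (Fin N)) :
    ∃ T : EuclideanSpace ℝ (Fin n) →L[ℝ] EuclideanSpace ℝ (Fin N × Fin n),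
      ∀ ζ, T ζ = rankOne ξ ζ := by
  refine ⟨LinearMap.toContinuousLinearMap
    { toFun := rankOne ξ, map_add' := ?_, map_smul' := ?_ }, fun ζ => rfl⟩
  · intro x y
    ext q
    simp [rankOne, mul_add]
  · intro c x
    ext q
    simp [rankOne]
    ring

lemma aux_gradMatrix {n N : ℕ} (ξ : EuclideanSpace ℝ (Fin N))
    (f : EuclideanSpace ℝ (Fin n) → ℝ) (hf : Differentiable ℝ f) (x : EuclideanSpace ℝ (Fin n)) :
    gradMatrix (fun x => f x • ξ) x = rankOne ξ (gradient f x) := by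
  ext q
  have h : HasFDerivAt (fun x => f x • ξ) _ x := (hf x).hasFDerivAt.smul_const ξ
  have e : gradient f x q.2 = fderiv ℝ f x (EuclideanSpace.single q.2 (1 : ℝ)) := by
    rw [← inner_gradient_left, EuclideanSpace.inner_single_right]
    simp
  simp [gradMatrix, rankOne, h.fderiv, e, mul_comm]

/-- If `F : ℝ^{N×n} → ℝ` is `C¹`, `C²` away from the origin, and strictly
degenerate quasiconvex with constant `λ > 0` and exponent `p ∈ (1,2)`, then for
every `z ≠ 0`, `ξ ∈ ℝ^N` and `ζ ∈ ℝⁿ` one has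
`∂²F(z)⟨ξ⊗ζ, ξ⊗ζ⟩ ≥ 2λ |z|^{p−2} |ξ|² |ζ|²`. -/
theorem strict_quasiconvexity_legendre_hadamard
    (n N : ℕ) (hn : 2 ≤ n) (hN : 1 ≤ N) (p : ℝ) (hp : 1 < p) (hp2 : p < 2)
    (lam : ℝ) (hlam : 0 < lam)
    (F : EuclideanSpace ℝ (Fin N × Fin n) → ℝ)
    (hF1 : ContDiff ℝ 1 F)
    (hF2 : ContDiffOn ℝ 2 F {(0 : EuclideanSpace ℝ (Fin N × Fin n))}ᶜ)
    (hqc : ∀ (x₀ : EuclideanSpace ℝ (Fin n)) (r : ℝ), 0 < r →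
      ∀ (z : EuclideanSpace ℝ (Fin N × Fin n))
        (φ : EuclideanSpace ℝ (Fin n) → EuclideanSpace ℝ (Fin N)),
        ContDiff ℝ (⊤ : ℕ∞) φ → HasCompactSupport φ → tsupport φ ⊆ Metric.ball x₀ r →
        (∫ x in Metric.ball x₀ r, (F (z + gradMatrix φ x) - F z) ∂volume) ≥
          lam * ∫ x in Metric.ball x₀ r,
            (‖z‖ ^ 2 + ‖gradMatrix φ x‖ ^ 2) ^ ((p - 2) / 2) *
              ‖gradMatrix φ x‖ ^ 2 ∂volume) :
    ∀ (z : EuclideanSpace ℝ (Fin N × Fin n)), z ≠ 0 →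
      ∀ (ξ : EuclideanSpace ℝ (Fin N)) (ζ : EuclideanSpace ℝ (Fin n)),
        fderiv ℝ (fderiv ℝ F) z (rankOne ξ ζ) (rankOne ξ ζ) ≥
          2 * lam * ‖z‖ ^ (p - 2) * ‖ξ‖ ^ 2 * ‖ζ‖ ^ 2 := by
  intro z hz ξ ζ
  obtain ⟨T, hT⟩ := aux_exists_T (n := n) ξ
  have hz0 : 0 < ‖z‖ := norm_pos_iff.2 hz
  have hFz : ContDiffAt ℝ 2 F z := hF2.contDiffAt (isOpen_compl_singleton.mem_nhds hz)
  have hF' : DifferentiableAt ℝ (fderiv ℝ F) z :=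
    (hFz.fderiv_right (m := 1) (by norm_num)).differentiableAt (by simp)
  have hsym : IsSymmSndFDerivAt ℝ F z := hFz.isSymmSndFDerivAt (by simp)
  set D2 := fderiv ℝ (fderiv ℝ F) z with hD2
  have hcontw : Continuous fun h : EuclideanSpace ℝ (Fin N × Fin n) =>
      (‖z‖ ^ 2 + ‖h‖ ^ 2) ^ ((p - 2) / 2) := by
    refine Continuous.rpow_const (by fun_prop) (fun h => Or.inl ?_)
    positivity
  have hw0 : (‖z‖ ^ 2) ^ ((p - 2) / 2) = ‖z‖ ^ (p - 2) := by
    rw [← Real.rpow_natCast, ← Real.rpow_mul hz0.le]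
    congr 1
    push_cast
    ring
  let G : EuclideanSpace ℝ (Fin n) → ℝ := fun v => (F (z + T v) - F z) -
    lam * ((‖z‖ ^ 2 + ‖T v‖ ^ 2) ^ ((p - 2) / 2) * ‖T v‖ ^ 2)
  have hFc := hF1.continuous
  have hG1 : Continuous fun v => F (z + T v) - F z := by fun_prop
  have hG2 : Continuous fun v => (‖z‖ ^ 2 + ‖T v‖ ^ 2) ^ ((p - 2) / 2) * ‖T v‖ ^ 2 :=
    (hcontw.comp T.continuous).mul (by fun_prop)
  have hG : Continuous G := hG1.sub (continuous_const.mul hG2)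
  have hG0 : G 0 = 0 := by simp [G]
  let B : EuclideanSpace ℝ (Fin n) →L[ℝ] EuclideanSpace ℝ (Fin n) →L[ℝ] ℝ :=
    (1 / 2 : ℝ) • (D2.bilinearComp T T) - (lam * ‖z‖ ^ (p - 2) * ‖ξ‖ ^ 2) •
      (isBoundedBilinearMap_inner (𝕜 := ℝ) (E := EuclideanSpace ℝ (Fin n))).toContinuousLinearMap
  have hTn : ∀ v, ‖T v‖ ^ 2 = ‖ξ‖ ^ 2 * ‖v‖ ^ 2 := fun v => by rw [hT, aux_norm_rankOne]
  have hBv : ∀ v, B v v = 1 / 2 * D2 (T v) (T v) - lam * ‖z‖ ^ (p - 2) * ‖T v‖ ^ 2 := by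
    intro v
    rw [hTn]
    simp [B]
    ring
  have hle : ∀ ε > 0, ∃ δ > 0, ∀ v, ‖v‖ < δ →
      G v ≤ ((fderiv ℝ F z).comp T) v + B v v + ε * ‖v‖ ^ 2 := by
    intro ε hε
    set η := ε / ((1 + lam) * (‖ξ‖ ^ 2 + 1)) with hη
    have hη0 : 0 < η := by positivity
    have hηε : η * (1 + lam) * ‖ξ‖ ^ 2 ≤ ε := by
      rw [hη, div_mul_eq_mul_div, div_mul_eq_mul_div, div_le_iff₀ (by positivity)]
      have : 0 < ε * (1 + lam) := by positivity
      nlinarith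
    obtain ⟨δ₁, hδ₁, H1⟩ := aux_taylor F z (hF1.differentiable (by simp)) hF' hsym η hη0
    have hw := hcontw.tendsto 0
    simp only [norm_zero, ne_eq, OfNat.ofNat_ne_zero, not_false_eq_true, zero_pow, add_zero,
      hw0] at hw
    obtain ⟨δ₂, hδ₂, H2⟩ := Metric.eventually_nhds_iff.1
      (hw.eventually (lt_mem_nhds (show ‖z‖ ^ (p - 2) - η < _ by linarith)))
    have hTc := T.continuous.tendsto 0
    rw [map_zero] at hTc
    obtain ⟨δ, hδ, H3⟩ := Metric.eventually_nhds_iff.1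
      (hTc.eventually (Metric.ball_mem_nhds 0 (lt_min hδ₁ hδ₂)))
    refine ⟨δ, hδ, fun v hv => ?_⟩
    have h3 := H3 (y := v) (by simpa using hv)
    rw [dist_zero_right, lt_min_iff] at h3
    have h1 := H1 (T v) h3.1
    have h2 := H2 (y := T v) (by simpa using h3.2)
    rw [hBv]
    simp only [G, ContinuousLinearMap.comp_apply]
    have h4 : lam * ((‖z‖ ^ (p - 2) - η) * ‖T v‖ ^ 2) ≤
        lam * ((‖z‖ ^ 2 + ‖T v‖ ^ 2) ^ ((p - 2) / 2) * ‖T v‖ ^ 2) := by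
      gcongr
    have h5 : η * (1 + lam) * ‖T v‖ ^ 2 ≤ ε * ‖v‖ ^ 2 := by
      rw [hTn, ← mul_assoc]
      gcongr
    linarith
  have hpos : ∀ f : EuclideanSpace ℝ (Fin n) → ℝ, ContDiff ℝ (⊤ : ℕ∞) f →
      HasCompactSupport f → 0 ≤ ∫ x, G (gradient f x) := by
    intro f hf hc
    have i1 := aux_integrable f hf hc _ hG1 (by simp)
    have i2 := aux_integrable f hf hc _ hG2 (by simp)
    obtain ⟨r, hr0, hr⟩ := hc.isCompact.isBounded.subset_ball_lt 0 0
    have hts : tsupport (fun x => f x • ξ) ⊆ tsupport f := tsupport_smul_subset_left f _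
    have key := hqc 0 r hr0 z (fun x => f x • ξ) (hf.smul contDiff_const) hc.smul_right
      (hts.trans hr)
    have hout : ∀ x, x ∉ Metric.ball (0 : EuclideanSpace ℝ (Fin n)) r → gradient f x = 0 := by
      intro x hx
      have : fderiv ℝ f x = 0 := by
        by_contra h
        exact hx (hr (support_fderiv_subset ℝ h))
      simp [gradient, this]
    simp_rw [aux_gradMatrix ξ f (hf.differentiable (by simp)), ← hT] at key
    rw [setIntegral_eq_integral_of_forall_compl_eq_zero (fun x hx => by simp [hout x hx]),
      setIntegral_eq_integral_of_forall_compl_eq_zero (fun x hx => by simp [hout x hx])] at key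
    simp only [G]
    rw [integral_sub i1 (i2.const_mul lam), integral_const_mul]
    linarith
  have := aux_B B (aux_A G hG hG0 _ B hle hpos) ζ
  rw [hBv, hTn, hT] at this
  have e : 2 * lam * ‖z‖ ^ (p - 2) * ‖ξ‖ ^ 2 * ‖ζ‖ ^ 2
    = 2 * (lam * ‖z‖ ^ (p - 2) * (‖ξ‖ ^ 2 * ‖ζ‖ ^ 2)) := by ring
  rw [e]
  linarith
end
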